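/- arXiv:1508.01760 — 5 statements merged into one kernel-verified Lean document; each statement's English description precedes it below -/
import Mathlib

section
/- Let β ∈ {1, 2} and let z ∈ ℂ satisfy −2/(3β²) < Re(z) ≤ 0, with z ≠ 0 in the case β = 1. There exists a constant C > 0 such that for all reals x ≥ 3 one has | Σ'_{n ≤ x} σ_{z,β}(n) − ζ(β(1−z))·x − ζ(z + 1/β)·x^{z + 1/β}/(1 + βz) | ≤ C · x^{1/3}(log x)^2. -/
open Complex Finset
open scoped Classical

/-- The generalized divisor function `σ_{z,β}(n) = Σ_{d^β ∣ n} d^{βz}`. -/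
noncomputable def sigmaGen (z : ℂ) (β : ℕ) (n : ℕ) : ℂ :=
  ∑ d ∈ (Finset.Icc 1 n).filter (fun d => d ^ β ∣ n), (d : ℂ) ^ ((β : ℂ) * z)

/-- The primed sum `Σ'_{n ≤ x} f(n)`: subtract `f(x)/2` when `x` is a positive integer. -/
noncomputable def primedSum (f : ℕ → ℂ) (x : ℝ) : ℂ :=
  (∑ n ∈ Finset.Icc 1 ⌊x⌋₊, f n) - (if (⌊x⌋₊ : ℝ) = x then f ⌊x⌋₊ / 2 else 0)

/-- The additive character `e(t) = exp(2πit)`. -/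
noncomputable def expCircle (t : ℝ) : ℂ := Complex.exp ((2 * Real.pi * t : ℝ) * I)

theorem norm_expCircle (t : ℝ) : ‖expCircle t‖ = 1 :=
  Complex.norm_exp_ofReal_mul_I _

theorem expCircle_add (s t : ℝ) : expCircle (s + t) = expCircle s * expCircle t := by
  rw [expCircle, expCircle, expCircle, ← Complex.exp_add]
  congr 1
  push_cast
  ring

theorem expCircle_int (k : ℤ) : expCircle k = 1 := by
  rw [expCircle, Complex.exp_eq_one_iff]
  exact ⟨k, by push_cast; ring⟩

theorem expCircle_re (t : ℝ) : (expCircle t).re = Real.cos (2 * Real.pi * t) :=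
  Complex.exp_ofReal_mul_I_re _

theorem norm_expCircle_sub_one_le (t : ℝ) : ‖expCircle t - 1‖ ≤ 2 * Real.pi * |t| := by
  have h := Real.norm_exp_I_mul_ofReal_sub_one_le (x := 2 * Real.pi * t)
  rw [expCircle, mul_comm]
  refine h.trans (le_of_eq ?_)
  rw [Real.norm_eq_abs, abs_mul, abs_of_pos Real.two_pi_pos]

/-- The coefficient `1 / (1 - e(t))`, in the form `1/2 + (i/2) cot(πt)`. -/
noncomputable def cotCoeff (t : ℝ) : ℂ := 1 / 2 + (Real.cot (Real.pi * t) / 2 : ℝ) * I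

theorem cotCoeff_mul (t : ℝ) (ht : Real.sin (Real.pi * t) ≠ 0) :
    cotCoeff t * (1 - expCircle t) = 1 := by
  have hs : Complex.sin (Real.pi * t) ≠ 0 := by exact_mod_cast ht
  have hE : expCircle t
      = (Complex.cos (Real.pi * t) + Complex.sin (Real.pi * t) * I) ^ 2 := by
    rw [← Complex.exp_mul_I, ← Complex.exp_nat_mul, expCircle]
    congr 1
    push_cast
    ring
  rw [cotCoeff, hE, Real.cot_eq_cos_div_sin]
  push_cast
  have h1 := Complex.sin_sq_add_cos_sq (Real.pi * t)
  field_simp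
  generalize Complex.sin (Real.pi * t) = a at *
  generalize Complex.cos (Real.pi * t) = b at *
  linear_combination (2 * a - (a + b * I)) * h1
    + (-a ^ 2 * (a + b * I) - 2 * a * b ^ 2) * Complex.I_sq

theorem cot_antitone {s t : ℝ} (hs : 0 < s) (hst : s ≤ t) (ht : t < Real.pi) :
    Real.cot t ≤ Real.cot s := by
  have h1 : 0 < Real.sin s := Real.sin_pos_of_pos_of_lt_pi hs (by linarith)
  have h2 : 0 < Real.sin t := Real.sin_pos_of_pos_of_lt_pi (by linarith) ht
  have h3 : 0 ≤ Real.sin (t - s) :=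
    Real.sin_nonneg_of_nonneg_of_le_pi (by linarith) (by linarith)
  rw [Real.cot_eq_cos_div_sin, Real.cot_eq_cos_div_sin, div_le_div_iff₀ h2 h1]
  rw [Real.sin_sub] at h3
  linarith

theorem sin_pi_mul_ge {δ t : ℝ} (hδ : 0 < δ) (h1 : δ ≤ t) (h2 : t ≤ 1 - δ) :
    2 * δ ≤ Real.sin (Real.pi * t) := by
  have hpi := Real.pi_pos
  have key : ∀ u : ℝ, δ ≤ u → u ≤ 1 / 2 → 2 * δ ≤ Real.sin (Real.pi * u) := by
    intro u hu1 hu2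
    have := Real.mul_le_sin (x := Real.pi * u) (by nlinarith) (by nlinarith)
    have h3 : 2 / Real.pi * (Real.pi * u) = 2 * u := by field_simp
    linarith
  rcases le_total t (1 / 2) with h | h
  · exact key t h1 h
  · have := key (1 - t) (by linarith) (by linarith)
    rwa [mul_sub, mul_one, Real.sin_pi_sub] at this

theorem abs_cot_le {δ t : ℝ} (hδ : 0 < δ) (h1 : δ ≤ t) (h2 : t ≤ 1 - δ) :
    |Real.cot (Real.pi * t)| ≤ 1 / (2 * δ) := by
  have h := sin_pi_mul_ge hδ h1 h2
  rw [Real.cot_eq_cos_div_sin, abs_div, abs_of_pos (by linarith : 0 < Real.sin (Real.pi * t))]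
  exact div_le_div₀ zero_le_one (Real.abs_cos_le_one _) (by linarith) h

theorem norm_cotCoeff_le {δ t : ℝ} (hδ : 0 < δ) (h1 : δ ≤ t) (h2 : t ≤ 1 - δ) :
    ‖cotCoeff t‖ ≤ 1 / (2 * δ) := by
  have hc := abs_cot_le hδ h1 h2
  have hδ' : 1 ≤ 1 / (2 * δ) := by
    rw [le_div_iff₀ (by linarith)]
    linarith
  calc ‖cotCoeff t‖ ≤ ‖(1 / 2 : ℂ)‖ + ‖((Real.cot (Real.pi * t) / 2 : ℝ) : ℂ) * I‖ :=
        norm_add_le _ _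
    _ = 1 / 2 + |Real.cot (Real.pi * t)| / 2 := by
        rw [norm_mul, Complex.norm_I, Complex.norm_real, Real.norm_eq_abs, abs_div]
        norm_num
    _ ≤ 1 / (2 * δ) := by linarith

/-- Kusmin–Landau inequality for differences lying in a unit interval starting at `0`. -/
theorem kusmin_landau_zero (f : ℕ → ℝ) {δ : ℝ} (hδ : 0 < δ) (a b : ℕ)
    (hg : ∀ n ∈ Finset.Ico a b, δ ≤ f (n + 1) - f n ∧ f (n + 1) - f n ≤ 1 - δ)
    (hm : ∀ n, a ≤ n → n + 1 < b → f (n + 1) - f n ≤ f (n + 2) - f (n + 1)) :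
    ‖∑ n ∈ Finset.Ico a b, expCircle (f n)‖ ≤ 2 / δ := by
  set g : ℕ → ℝ := fun n => f (n + 1) - f n with hgdef
  have hstep : ∀ n ∈ Finset.Ico a b,
      expCircle (f n) = cotCoeff (g n) * expCircle (f n)
        - cotCoeff (g n) * expCircle (f (n + 1)) := by
    intro n hn
    have h := sin_pi_mul_ge hδ (hg n hn).1 (hg n hn).2
    have h2 := cotCoeff_mul (g n) (by simp only [hgdef]; linarith)
    have h3 : f (n + 1) = f n + g n := by simp only [hgdef]; ring
    rw [h3, expCircle_add]
    linear_combination -expCircle (f n) * h2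
  rcases le_or_gt b a with hab | hab
  · rw [Finset.Ico_eq_empty (by omega), Finset.sum_empty, norm_zero]
    positivity
  have main : ∀ k, a + k + 1 ≤ b →
      ‖∑ n ∈ Finset.Ico a (a + k + 1), expCircle (f n)
        + cotCoeff (g (a + k)) * expCircle (f (a + k + 1))‖
      ≤ ‖cotCoeff (g a)‖
        + (Real.cot (Real.pi * g a) - Real.cot (Real.pi * g (a + k))) / 2 := by
    intro k
    induction k with
    | zero =>
      intro hk
      have : Finset.Ico a (a + 0 + 1) = {a} := by ext; simp
      rw [this, Finset.sum_singleton, hstep a (Finset.mem_Ico.2 ⟨by omega, by omega⟩)]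
      simp [norm_expCircle]
    | succ k ih =>
      intro hk
      have ih' := ih (by omega)
      have e1 : a + (k + 1) = a + k + 1 := by ring
      rw [e1, Finset.sum_Ico_succ_top (by omega)]
      have hst := hstep (a + k + 1) (Finset.mem_Ico.2 ⟨by omega, by omega⟩)
      have heq : ∑ n ∈ Finset.Ico a (a + k + 1), expCircle (f n) + expCircle (f (a + k + 1))
          + cotCoeff (g (a + k + 1)) * expCircle (f (a + k + 1 + 1))
        = (∑ n ∈ Finset.Ico a (a + k + 1), expCircle (f n)
          + cotCoeff (g (a + k)) * expCircle (f (a + k + 1)))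
          + (cotCoeff (g (a + k + 1)) - cotCoeff (g (a + k))) * expCircle (f (a + k + 1)) := by
        linear_combination hst
      rw [heq]
      have h0 := hg (a + k) (Finset.mem_Ico.2 ⟨by omega, by omega⟩)
      have h1 := hg (a + k + 1) (Finset.mem_Ico.2 ⟨by omega, by omega⟩)
      have hmono : g (a + k) ≤ g (a + k + 1) := hm (a + k) (by omega) (by omega)
      have hpi := Real.pi_pos
      have hcot : Real.cot (Real.pi * g (a + k + 1)) ≤ Real.cot (Real.pi * g (a + k)) := by
        apply cot_antitone
        · exact mul_pos hpi (by simp only [hgdef]; linarith)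
        · gcongr
        · have : g (a + k + 1) < 1 := by simp only [hgdef]; linarith
          nlinarith
      have hn : ‖(cotCoeff (g (a + k + 1)) - cotCoeff (g (a + k))) * expCircle (f (a + k + 1))‖
          = (Real.cot (Real.pi * g (a + k)) - Real.cot (Real.pi * g (a + k + 1))) / 2 := by
        rw [norm_mul, norm_expCircle, mul_one]
        have : cotCoeff (g (a + k + 1)) - cotCoeff (g (a + k))
          = (((Real.cot (Real.pi * g (a + k + 1)) - Real.cot (Real.pi * g (a + k))) / 2 : ℝ) : ℂ)
            * I := by
          simp only [cotCoeff]; push_cast; ring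
        rw [this, norm_mul, Complex.norm_I, Complex.norm_real, Real.norm_eq_abs,
          abs_of_nonpos (by linarith)]
        ring
      calc _ ≤ _ := norm_add_le _ _
        _ ≤ _ := add_le_add ih' hn.le
        _ = _ := by ring
  obtain ⟨k, rfl⟩ : ∃ k, b = a + k + 1 := ⟨b - a - 1, by omega⟩
  have h := main k le_rfl
  have ha := hg a (Finset.mem_Ico.2 ⟨by omega, by omega⟩)
  have hb := hg (a + k) (Finset.mem_Ico.2 ⟨by omega, by omega⟩)
  have c1 := norm_cotCoeff_le hδ ha.1 ha.2
  have c2 := norm_cotCoeff_le hδ hb.1 hb.2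
  have c3 := abs_le.1 (abs_cot_le hδ ha.1 ha.2)
  have c4 := abs_le.1 (abs_cot_le hδ hb.1 hb.2)
  have htri : ‖∑ n ∈ Finset.Ico a (a + k + 1), expCircle (f n)‖
      ≤ ‖∑ n ∈ Finset.Ico a (a + k + 1), expCircle (f n)
        + cotCoeff (g (a + k)) * expCircle (f (a + k + 1))‖ + ‖cotCoeff (g (a + k))‖ := by
    have := norm_sub_le (∑ n ∈ Finset.Ico a (a + k + 1), expCircle (f n)
        + cotCoeff (g (a + k)) * expCircle (f (a + k + 1)))
        (cotCoeff (g (a + k)) * expCircle (f (a + k + 1)))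
    rwa [add_sub_cancel_right, norm_mul, norm_expCircle, mul_one] at this
  have e : 2 / δ = 4 * (1 / (2 * δ)) := by field_simp; norm_num
  have hpos : 0 < 1 / (2 * δ) := by positivity
  simp only [hgdef] at *
  linarith [c3.2, c4.1]

/-- Kusmin–Landau inequality. -/
theorem kusmin_landau (f : ℕ → ℝ) {δ : ℝ} (hδ : 0 < δ) (a b : ℕ) (k : ℤ)
    (hg : ∀ n ∈ Finset.Ico a b, k + δ ≤ f (n + 1) - f n ∧ f (n + 1) - f n ≤ k + 1 - δ)
    (hm : ∀ n, a ≤ n → n + 1 < b → f (n + 1) - f n ≤ f (n + 2) - f (n + 1)) :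
    ‖∑ n ∈ Finset.Ico a b, expCircle (f n)‖ ≤ 2 / δ := by
  have h := kusmin_landau_zero (fun n => f n + ((-k * n : ℤ) : ℝ)) hδ a b
    (fun n hn => by
      have := hg n hn
      push_cast
      constructor <;> linarith [this.1, this.2])
    (fun n h1 h2 => by
      have := hm n h1 h2
      push_cast
      linarith)
  simpa only [expCircle_add, expCircle_int, mul_one] using h

theorem add_mul_le_of_spaced {g : ℕ → ℝ} {lam : ℝ} {A B : ℕ}
    (hs : ∀ n, A ≤ n → n + 1 < B → g n + lam ≤ g (n + 1)) {m M : ℕ} (hA : A ≤ m) (hm : m ≤ M)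
    (hB : M < B) : g m + (M - m : ℝ) * lam ≤ g M := by
  induction M, hm using Nat.le_induction with
  | base => simp
  | succ M hmM ih =>
    have h1 := ih (by omega)
    have h2 := hs M (by omega) (by omega)
    push_cast
    linarith

theorem card_le_of_spaced {g : ℕ → ℝ} {lam : ℝ} (hlam : 0 < lam) {A B : ℕ}
    (hs : ∀ n, A ≤ n → n + 1 < B → g n + lam ≤ g (n + 1)) {α η : ℝ} (hη : 0 ≤ η)
    (S : Finset ℕ) (hS : S ⊆ Finset.Ico A B) (hg : ∀ n ∈ S, α ≤ g n ∧ g n ≤ α + η) :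
    (S.card : ℝ) ≤ η / lam + 1 := by
  rcases S.eq_empty_or_nonempty with rfl | hne
  · simp; positivity
  have hmin := S.min'_mem hne
  have hmax := S.max'_mem hne
  have hle : S.min' hne ≤ S.max' hne := S.min'_le _ hmax
  have h1 := Finset.mem_Ico.1 (hS hmin)
  have h2 := Finset.mem_Ico.1 (hS hmax)
  have h3 := add_mul_le_of_spaced hs h1.1 hle h2.2
  have h4 : S.card ≤ S.max' hne + 1 - S.min' hne := by
    rw [← Nat.card_Icc]
    exact Finset.card_le_card fun n hn => Finset.mem_Icc.2 ⟨S.min'_le _ hn, S.le_max' _ hn⟩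
  have h5 : (S.card : ℝ) ≤ (S.max' hne : ℝ) + 1 - S.min' hne := by
    have : S.card + S.min' hne ≤ S.max' hne + 1 := by omega
    have : (S.card : ℝ) + S.min' hne ≤ S.max' hne + 1 := by exact_mod_cast this
    linarith
  have h6 : ((S.max' hne : ℝ) - S.min' hne) ≤ η / lam := by
    rw [le_div_iff₀ hlam]
    linarith [(hg _ hmin).1, (hg _ hmax).2]
  linarith

theorem exists_eq_Ico_of_spaced {g : ℕ → ℝ} {lam : ℝ} (hlam : 0 < lam) {A B : ℕ}
    (hs : ∀ n, A ≤ n → n + 1 < B → g n + lam ≤ g (n + 1)) (u v : ℝ) :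
    ∃ a b, (Finset.Ico A B).filter (fun n => u ≤ g n ∧ g n ≤ v) = Finset.Ico a b := by
  have hmono : ∀ {m M : ℕ}, A ≤ m → m ≤ M → M < B → g m ≤ g M := by
    intro m M h1 h2 h3
    have h4 := add_mul_le_of_spaced hs h1 h2 h3
    have h5 : (m : ℝ) ≤ M := by exact_mod_cast h2
    nlinarith
  set S := (Finset.Ico A B).filter (fun n => u ≤ g n ∧ g n ≤ v) with hS
  rcases S.eq_empty_or_nonempty with h | hne
  · exact ⟨0, 0, by simp [h]⟩
  refine ⟨S.min' hne, S.max' hne + 1, ?_⟩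
  have hmin := S.min'_mem hne
  have hmax := S.max'_mem hne
  ext n
  constructor
  · intro hn
    exact Finset.mem_Ico.2 ⟨S.min'_le _ hn, Nat.lt_succ_of_le (S.le_max' _ hn)⟩
  · intro hn
    obtain ⟨hn1, hn2⟩ := Finset.mem_Ico.1 hn
    obtain ⟨hm1, hm2⟩ := Finset.mem_filter.1 hmin
    obtain ⟨hM1, hM2⟩ := Finset.mem_filter.1 hmax
    rw [Finset.mem_Ico] at hm1 hM1
    refine Finset.mem_filter.2 ⟨Finset.mem_Ico.2 ⟨by omega, by omega⟩, ?_, ?_⟩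
    · exact hm2.1.trans (hmono hm1.1 hn1 (by omega))
    · exact (hmono (by omega) (by omega) hM1.2).trans hM2.2

/-- Van der Corput's second derivative test, in terms of first differences. -/
theorem van_der_corput (f : ℕ → ℝ) {lam : ℝ} (hlam : 0 < lam) (hlam1 : lam ≤ 1) {A B : ℕ}
    {u V : ℝ} (hV : 0 ≤ V)
    (hs : ∀ n, A ≤ n → n + 1 < B → f (n + 1) - f n + lam ≤ f (n + 2) - f (n + 1))
    (hr : ∀ n ∈ Finset.Ico A B, u ≤ f (n + 1) - f n ∧ f (n + 1) - f n ≤ u + V) :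
    ‖∑ n ∈ Finset.Ico A B, expCircle (f n)‖ ≤ (V + 2) * (7 / Real.sqrt lam) := by
  set g : ℕ → ℝ := fun n => f (n + 1) - f n with hg
  have hs' : ∀ n, A ≤ n → n + 1 < B → g n + lam ≤ g (n + 1) := hs
  have hsq : 0 < Real.sqrt lam := Real.sqrt_pos.2 hlam
  have hsq1 : Real.sqrt lam ≤ 1 := Real.sqrt_le_one.2 hlam1
  have hsqsq : Real.sqrt lam * Real.sqrt lam = lam := Real.mul_self_sqrt hlam.le
  set δ := Real.sqrt lam / 2 with hδdef
  have hδ : 0 < δ := by positivity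
  have fiber : ∀ k : ℤ, ‖∑ n ∈ (Finset.Ico A B).filter (fun n => ⌊g n⌋ = k), expCircle (f n)‖
      ≤ 7 / Real.sqrt lam := by
    intro k
    set S := (Finset.Ico A B).filter (fun n => ⌊g n⌋ = k) with hS
    have hSsub : S ⊆ Finset.Ico A B := Finset.filter_subset _ _
    have hSmem : ∀ n ∈ S, (k : ℝ) ≤ g n ∧ g n < k + 1 := by
      intro n hn
      exact Int.floor_eq_iff.1 (Finset.mem_filter.1 hn).2
    rw [← Finset.sum_filter_add_sum_filter_not S (fun n => k + δ ≤ g n ∧ g n ≤ k + 1 - δ)]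
    have hmid : S.filter (fun n => k + δ ≤ g n ∧ g n ≤ k + 1 - δ)
        = (Finset.Ico A B).filter (fun n => k + δ ≤ g n ∧ g n ≤ k + 1 - δ) := by
      ext n
      simp only [hS, Finset.mem_filter]
      constructor
      · rintro ⟨⟨h1, -⟩, h2⟩
        exact ⟨h1, h2⟩
      · rintro ⟨h1, h2⟩
        exact ⟨⟨h1, Int.floor_eq_iff.2 ⟨by linarith [h2.1], by linarith [h2.2]⟩⟩, h2⟩
    have hn1 : ‖∑ n ∈ S.filter (fun n => k + δ ≤ g n ∧ g n ≤ k + 1 - δ), expCircle (f n)‖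
        ≤ 2 / δ := by
      obtain ⟨a, b, hab⟩ := exists_eq_Ico_of_spaced hlam hs' (k + δ) (k + 1 - δ)
      rw [hmid, hab]
      have hmem : ∀ n ∈ Finset.Ico a b, n ∈ Finset.Ico A B ∧
          (k + δ ≤ g n ∧ g n ≤ k + 1 - δ) := by
        intro n hn
        rw [← hab] at hn
        exact Finset.mem_filter.1 hn
      apply kusmin_landau f hδ a b k (fun n hn => (hmem n hn).2)
      intro n h1 h2
      have m1 := Finset.mem_Ico.1 (hmem n (Finset.mem_Ico.2 ⟨by omega, by omega⟩)).1
      have m2 := Finset.mem_Ico.1 (hmem (n + 1) (Finset.mem_Ico.2 ⟨by omega, by omega⟩)).1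
      have := hs n m1.1 m2.2
      linarith
    have hn2 : ‖∑ n ∈ S.filter (fun n => ¬ (k + δ ≤ g n ∧ g n ≤ k + 1 - δ)), expCircle (f n)‖
        ≤ (δ / lam + 1) + (δ / lam + 1) := by
      refine (norm_sum_le _ _).trans ?_
      simp only [norm_expCircle, Finset.sum_const, nsmul_eq_mul, mul_one]
      have hsub : S.filter (fun n => ¬ (k + δ ≤ g n ∧ g n ≤ k + 1 - δ))
          ⊆ S.filter (fun n => g n ≤ k + δ) ∪ S.filter (fun n => k + 1 - δ ≤ g n) := by
        intro n hn
        obtain ⟨h1, h2⟩ := Finset.mem_filter.1 hn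
        rw [Finset.mem_union]
        rcases not_and_or.1 h2 with h | h
        · exact Or.inl (Finset.mem_filter.2 ⟨h1, (not_le.1 h).le⟩)
        · exact Or.inr (Finset.mem_filter.2 ⟨h1, (not_le.1 h).le⟩)
      have hc := (Finset.card_le_card hsub).trans (Finset.card_union_le _ _)
      have c1 := card_le_of_spaced hlam hs' (α := k) hδ.le (S.filter (fun n => g n ≤ k + δ))
        ((Finset.filter_subset _ _).trans hSsub) (fun n hn => by
          obtain ⟨h1, h2⟩ := Finset.mem_filter.1 hn
          exact ⟨(hSmem n h1).1, h2⟩)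
      have c2 := card_le_of_spaced hlam hs' (α := k + 1 - δ) hδ.le
        (S.filter (fun n => k + 1 - δ ≤ g n))
        ((Finset.filter_subset _ _).trans hSsub) (fun n hn => by
          obtain ⟨h1, h2⟩ := Finset.mem_filter.1 hn
          exact ⟨h2, by linarith [(hSmem n h1).2]⟩)
      have hc' : ((S.filter (fun n => ¬ (k + δ ≤ g n ∧ g n ≤ k + 1 - δ))).card : ℝ)
          ≤ (S.filter (fun n => g n ≤ k + δ)).card
            + (S.filter (fun n => k + 1 - δ ≤ g n)).card := by exact_mod_cast hc
      linarith
    have e1 : 2 / δ = 4 / Real.sqrt lam := by rw [hδdef]; field_simp; norm_num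
    have e2 : δ / lam = 1 / Real.sqrt lam / 2 := by
      rw [hδdef, div_div, div_div, div_eq_div_iff (by positivity) (by positivity)]
      linear_combination 2 * hsqsq
    have e3 : 1 ≤ 1 / Real.sqrt lam := by
      rw [le_div_iff₀ hsq]; linarith
    calc _ ≤ _ := norm_add_le _ _
      _ ≤ 2 / δ + ((δ / lam + 1) + (δ / lam + 1)) := add_le_add hn1 hn2
      _ ≤ 7 / Real.sqrt lam := by
        rw [e1, e2, div_eq_mul_one_div 4, div_eq_mul_one_div 7]; linarith
  have hmaps : ∀ n ∈ Finset.Ico A B, ⌊g n⌋ ∈ Finset.Icc ⌊u⌋ ⌊u + V⌋ := fun n hn =>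
    Finset.mem_Icc.2 ⟨Int.floor_le_floor (hr n hn).1, Int.floor_le_floor (hr n hn).2⟩
  rw [← Finset.sum_fiberwise_of_maps_to hmaps]
  refine (norm_sum_le _ _).trans ((Finset.sum_le_sum fun k _ => fiber k).trans ?_)
  rw [Finset.sum_const, nsmul_eq_mul, Int.card_Icc]
  gcongr
  have h1 : ⌊u⌋ ≤ ⌊u + V⌋ := Int.floor_le_floor (by linarith)
  have h2 : (((⌊u + V⌋ + 1 - ⌊u⌋).toNat : ℤ) : ℝ) = ⌊u + V⌋ + 1 - ⌊u⌋ := by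
    rw [Int.toNat_of_nonneg (by omega)]; push_cast; ring
  rw [Int.cast_natCast] at h2
  rw [h2]
  linarith [Int.floor_le (u + V), Int.lt_floor_add_one u]

/-- The sawtooth function `ψ(t) = {t} - 1/2`. -/
noncomputable def sawtooth (t : ℝ) : ℝ := Int.fract t - 1 / 2

theorem abs_sawtooth_le (t : ℝ) : |sawtooth t| ≤ 1 / 2 := by
  rw [sawtooth, abs_le]
  constructor <;> linarith [Int.fract_nonneg t, Int.fract_lt_one t]

/-- The periodic second Bernoulli function. -/
noncomputable def bernoulliTwo (t : ℝ) : ℝ := Int.fract t ^ 2 - Int.fract t + 1 / 6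

theorem hasSum_cos_bernoulliTwo (t : ℝ) :
    HasSum (fun n : ℕ => 1 / (n : ℝ) ^ 2 * Real.cos (2 * Real.pi * (n * t)))
      (Real.pi ^ 2 * bernoulliTwo t) := by
  have h := hasSum_one_div_nat_pow_mul_cos (k := 1) one_ne_zero (x := Int.fract t)
    ⟨Int.fract_nonneg t, (Int.fract_lt_one t).le⟩
  have hB : (Polynomial.map (algebraMap ℚ ℝ) (Polynomial.bernoulli (2 * 1))).eval (Int.fract t)
      = bernoulliTwo t := by
    have := bernoulliFun_two (Int.fract t)
    rw [bernoulliFun] at this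
    rw [mul_one, bernoulliTwo]
    convert this using 2
    norm_num
  rw [hB] at h
  convert h using 1
  · ext n
    rw [mul_one]
    congr 1
    rw [← Real.cos_sub_int_mul_two_pi (2 * Real.pi * (n * t)) (n * ⌊t⌋)]
    congr 1
    rw [← Int.self_sub_floor]
    push_cast
    ring
  · have h2 : ((2 * 1).factorial : ℝ) = 2 := by norm_num [Nat.factorial]
    rw [h2]
    ring

theorem sawtooth_ge {δ : ℝ} (hδ : 0 < δ) (hδ1 : δ ≤ 1) (t : ℝ) :
    bernoulliTwo (t + δ) - bernoulliTwo t - δ ^ 2 ≤ 2 * δ * sawtooth t := by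
  have h0 := Int.fract_nonneg t
  have h1 := Int.fract_lt_one t
  have ht := Int.floor_add_fract t
  rw [bernoulliTwo, bernoulliTwo, sawtooth]
  rcases lt_or_ge (Int.fract t + δ) 1 with h | h
  · have : Int.fract (t + δ) = Int.fract t + δ :=
      Int.fract_eq_iff.2 ⟨by linarith, h, ⌊t⌋, by linarith⟩
    rw [this]
    nlinarith
  · have : Int.fract (t + δ) = Int.fract t + δ - 1 :=
      Int.fract_eq_iff.2 ⟨by linarith, by linarith, ⌊t⌋ + 1, by push_cast; linarith⟩
    rw [this]
    nlinarith

theorem sawtooth_le {δ : ℝ} (hδ : 0 < δ) (hδ1 : δ ≤ 1) (t : ℝ) :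
    2 * δ * sawtooth t ≤ bernoulliTwo t - bernoulliTwo (t - δ) + δ ^ 2 := by
  have h0 := Int.fract_nonneg t
  have h1 := Int.fract_lt_one t
  have ht := Int.floor_add_fract t
  rw [bernoulliTwo, bernoulliTwo, sawtooth]
  rcases lt_or_ge (Int.fract t) δ with h | h
  · have : Int.fract (t - δ) = Int.fract t - δ + 1 :=
      Int.fract_eq_iff.2 ⟨by linarith, by linarith, ⌊t⌋ - 1, by push_cast; linarith⟩
    rw [this]
    nlinarith
  · have : Int.fract (t - δ) = Int.fract t - δ :=
      Int.fract_eq_iff.2 ⟨by linarith, by linarith, ⌊t⌋, by linarith⟩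
    rw [this]
    nlinarith

theorem sum_range_le_four_div_sqrt {t : ℕ → ℝ} {K : ℕ} (hK : 0 < K) (h0 : t 0 = 0)
    (h1 : ∀ h : ℕ, 0 < h → t h ≤ 1 / (K * Real.sqrt h))
    (h2 : ∀ h : ℕ, 0 < h → t h ≤ 1 / (h * Real.sqrt h)) (N : ℕ) :
    ∑ h ∈ Finset.range (N + 1), t h ≤ 4 / Real.sqrt K := by
  have hK' : (0 : ℝ) < K := by exact_mod_cast hK
  have hsK : 0 < Real.sqrt K := Real.sqrt_pos.2 hK'
  have hsK2 : Real.sqrt K * Real.sqrt K = K := Real.mul_self_sqrt hK'.le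
  have hsucc : ∀ n : ℕ, Real.sqrt (n + 1 : ℕ) * Real.sqrt (n + 1 : ℕ)
      = Real.sqrt n * Real.sqrt n + 1 := by
    intro n
    rw [Real.mul_self_sqrt (Nat.cast_nonneg _), Real.mul_self_sqrt (Nat.cast_nonneg _)]
    push_cast
    ring
  have hpos : ∀ n : ℕ, 0 < n → 0 < Real.sqrt n := fun n hn =>
    Real.sqrt_pos.2 (by exact_mod_cast hn)
  have hle : ∀ n : ℕ, Real.sqrt n ≤ Real.sqrt (n + 1 : ℕ) := fun n =>
    Real.sqrt_le_sqrt (by push_cast; linarith)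
  have small : ∀ N : ℕ, ∑ h ∈ Finset.range (N + 1), t h ≤ 2 * Real.sqrt N / K := by
    intro N
    induction N with
    | zero => simp [h0]
    | succ n ih =>
      rw [Finset.sum_range_succ]
      have ht := h1 (n + 1) (by omega)
      have hb := hpos (n + 1) (by omega)
      have ha := Real.sqrt_nonneg (n : ℝ)
      have hab := hle n
      have hsq := hsucc n
      have key : 1 / (K * Real.sqrt (n + 1 : ℕ))
          ≤ 2 * Real.sqrt (n + 1 : ℕ) / K - 2 * Real.sqrt n / K := by
        rw [← sub_div, div_le_div_iff₀ (by positivity) hK']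
        have : 1 ≤ (2 * Real.sqrt (n + 1 : ℕ) - 2 * Real.sqrt n) * Real.sqrt (n + 1 : ℕ) := by
          nlinarith
        nlinarith
      linarith
  have large : ∀ N, K ≤ N →
      ∑ h ∈ Finset.range (N + 1), t h ≤ 4 / Real.sqrt K - 2 / Real.sqrt N := by
    intro N hN
    induction N, hN using Nat.le_induction with
    | base =>
      refine (small K).trans (le_of_eq ?_)
      rw [← sub_div, div_eq_div_iff hK'.ne' hsK.ne']
      linear_combination 2 * hsK2
    | succ n hn ih =>
      rw [Finset.sum_range_succ]
      have ht := h2 (n + 1) (by omega)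
      have hb := hpos (n + 1) (by omega)
      have ha := hpos n (by omega)
      have hab := hle n
      have hsq := hsucc n
      have hn1 : ((n + 1 : ℕ) : ℝ) = Real.sqrt (n + 1 : ℕ) * Real.sqrt (n + 1 : ℕ) :=
        (Real.mul_self_sqrt (Nat.cast_nonneg _)).symm
      have key : 1 / (((n + 1 : ℕ) : ℝ) * Real.sqrt (n + 1 : ℕ))
          ≤ 2 / Real.sqrt n - 2 / Real.sqrt (n + 1 : ℕ) := by
        rw [div_sub_div _ _ ha.ne' hb.ne', div_le_div_iff₀ (by positivity) (by positivity),
          show ((n + 1 : ℕ) : ℝ) * Real.sqrt (n + 1 : ℕ)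
            = Real.sqrt (n + 1 : ℕ) * Real.sqrt (n + 1 : ℕ) * Real.sqrt (n + 1 : ℕ) by rw [← hn1]]
        generalize Real.sqrt (n + 1 : ℕ) = b at *
        generalize Real.sqrt (n : ℝ) = a at *
        have h3 : (b - a) * (b + a) = 1 := by linarith
        have h4 : a * (b + a) ≤ 2 * (b * b) := by nlinarith
        have h5 : 0 ≤ b - a := by linarith
        have h6 : a ≤ (b - a) * (2 * (b * b)) := by
          calc a = (b - a) * (a * (b + a)) := by linear_combination -a * h3
            _ ≤ _ := mul_le_mul_of_nonneg_left h4 h5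
        nlinarith
      linarith
  rcases le_total N K with h | h
  · refine (small N).trans ?_
    have : Real.sqrt N ≤ Real.sqrt K := Real.sqrt_le_sqrt (by exact_mod_cast h)
    rw [div_le_div_iff₀ hK' hsK]
    nlinarith
  · have := large N h
    have h' : 0 ≤ 2 / Real.sqrt N := by positivity
    linarith

theorem abs_sum_bernoulliTwo_sub_le (s : Finset ℕ) (f : ℕ → ℝ) {M : ℝ} (hM : 0 ≤ M) {K : ℕ}
    (hK : 0 < K) (hS : ∀ h : ℕ, 0 < h → ‖∑ n ∈ s, expCircle (h * f n)‖ ≤ M * Real.sqrt h)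
    {ε : ℝ} (hε : |ε| = 1 / K) :
    |∑ n ∈ s, (bernoulliTwo (f n + ε) - bernoulliTwo (f n))| ≤ 4 * M / Real.sqrt K := by
  have hpi := Real.pi_pos
  have hpi3 := Real.pi_gt_three
  have hK' : (0 : ℝ) < K := by exact_mod_cast hK
  set T := ∑ n ∈ s, (bernoulliTwo (f n + ε) - bernoulliTwo (f n)) with hT
  set F : ℕ → ℝ := fun h => ∑ n ∈ s, (1 / (h : ℝ) ^ 2 * Real.cos (2 * Real.pi * (h * (f n + ε)))
    - 1 / (h : ℝ) ^ 2 * Real.cos (2 * Real.pi * (h * f n))) with hF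
  have hsum : HasSum F (Real.pi ^ 2 * T) := by
    rw [hT, Finset.mul_sum]
    refine hasSum_sum fun n _ => ?_
    rw [mul_sub]
    exact (hasSum_cos_bernoulliTwo _).sub (hasSum_cos_bernoulliTwo _)
  have hFle : ∀ h : ℕ, 0 < h →
      |F h| ≤ 1 / (h : ℝ) ^ 2 * (‖expCircle (h * ε) - 1‖ * (M * Real.sqrt h)) := by
    intro h hh
    have : F h = 1 / (h : ℝ) ^ 2
        * ((expCircle (h * ε) - 1) * ∑ n ∈ s, expCircle (h * f n)).re := by
      rw [Finset.mul_sum, Complex.re_sum, Finset.mul_sum]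
      refine Finset.sum_congr rfl fun n _ => ?_
      rw [sub_mul, one_mul, ← expCircle_add, Complex.sub_re, expCircle_re, expCircle_re]
      ring_nf
    rw [this, abs_mul, abs_of_nonneg (by positivity : 0 ≤ 1 / (h : ℝ) ^ 2)]
    gcongr
    refine (Complex.abs_re_le_norm _).trans ?_
    rw [norm_mul]
    gcongr
    exact hS h hh
  have hM' : 0 ≤ 2 * Real.pi * M := by positivity
  have hF0 : F 0 = 0 := by simp [hF]
  have hhs : ∀ h : ℕ, 0 < h → (h : ℝ) = Real.sqrt h * Real.sqrt h ∧ 0 < Real.sqrt h :=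
    fun h hh => ⟨(Real.mul_self_sqrt (Nat.cast_nonneg _)).symm,
      Real.sqrt_pos.2 (by exact_mod_cast hh)⟩
  have hF1 : ∀ h : ℕ, 0 < h → |F h| ≤ 2 * Real.pi * M * (1 / (K * Real.sqrt h)) := by
    intro h hh
    obtain ⟨e1, e2⟩ := hhs h hh
    have hn := norm_expCircle_sub_one_le (h * ε)
    rw [abs_mul, hε, Nat.abs_cast] at hn
    calc |F h| ≤ _ := hFle h hh
      _ ≤ 1 / (h : ℝ) ^ 2 * (2 * Real.pi * (h * (1 / K)) * (M * Real.sqrt h)) := by gcongr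
      _ = 2 * Real.pi * M * (1 / (K * Real.sqrt h)) := by
        generalize Real.sqrt h = r at *
        rw [e1]
        field_simp
  have hF2 : ∀ h : ℕ, 0 < h → |F h| ≤ 2 * Real.pi * M * (1 / (h * Real.sqrt h)) := by
    intro h hh
    obtain ⟨e1, e2⟩ := hhs h hh
    have hn : ‖expCircle (h * ε) - 1‖ ≤ 2 * Real.pi := by
      refine (norm_sub_le _ _).trans ?_
      rw [norm_expCircle, norm_one]
      linarith
    calc |F h| ≤ _ := hFle h hh
      _ ≤ 1 / (h : ℝ) ^ 2 * (2 * Real.pi * (M * Real.sqrt h)) := by gcongr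
      _ = 2 * Real.pi * M * (1 / (h * Real.sqrt h)) := by
        generalize Real.sqrt h = r at *
        rw [e1]
        field_simp
  have hpart : ∀ N : ℕ, |∑ h ∈ Finset.range (N + 1), F h| ≤ 2 * Real.pi * M * (4 / Real.sqrt K) := by
    intro N
    refine (Finset.abs_sum_le_sum_abs _ _).trans ?_
    rcases hM'.eq_or_lt with h0 | hpos
    · rw [← h0, zero_mul]
      refine (Finset.sum_nonpos fun h _ => ?_)
      rcases Nat.eq_zero_or_pos h with rfl | hh
      · simp [hF0]
      · have := hF1 h hh
        rwa [← h0, zero_mul] at this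
    · have := sum_range_le_four_div_sqrt (t := fun h => |F h| / (2 * Real.pi * M)) hK
        (by simp [hF0]) (fun h hh => by rw [div_le_iff₀' hpos]; exact hF1 h hh)
        (fun h hh => by rw [div_le_iff₀' hpos]; exact hF2 h hh) N
      rwa [← Finset.sum_div, div_le_iff₀' hpos] at this
  have hlim := (hsum.tendsto_sum_nat.comp (Filter.tendsto_add_atTop_nat 1)).abs
  have hfin := le_of_tendsto' hlim hpart
  rw [abs_mul, abs_of_pos (by positivity : 0 < Real.pi ^ 2)] at hfin
  have hR : 0 ≤ M / Real.sqrt K := by positivity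
  rw [mul_div_assoc]
  have e3 : 2 * Real.pi * M * (4 / Real.sqrt K) = Real.pi * (8 * (M / Real.sqrt K)) := by ring
  rw [e3, sq, mul_assoc] at hfin
  have h8 := le_of_mul_le_mul_left hfin hpi
  by_contra hcon
  push Not at hcon
  nlinarith

theorem abs_sum_sawtooth_le (s : Finset ℕ) (f : ℕ → ℝ) {M : ℝ} (hM : 0 ≤ M) {K : ℕ}
    (hK : 0 < K) (hS : ∀ h : ℕ, 0 < h → ‖∑ n ∈ s, expCircle (h * f n)‖ ≤ M * Real.sqrt h) :
    |∑ n ∈ s, sawtooth (f n)| ≤ s.card / (2 * K) + 2 * M * Real.sqrt K := by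
  have hK' : (0 : ℝ) < K := by exact_mod_cast hK
  have hK1 : (1 : ℝ) ≤ K := by exact_mod_cast hK
  have hδ : (0 : ℝ) < 1 / K := by positivity
  have hδ1 : (1 : ℝ) / K ≤ 1 := by rw [div_le_one hK']; exact hK1
  have hsK : 0 < Real.sqrt K := Real.sqrt_pos.2 hK'
  have hsK2 : Real.sqrt K * Real.sqrt K = K := Real.mul_self_sqrt hK'.le
  have h1 := (abs_le.1 (abs_sum_bernoulliTwo_sub_le s f hM hK hS (abs_of_pos hδ))).1
  have h2 := (abs_le.1 (abs_sum_bernoulliTwo_sub_le s f hM hK hS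
    (by rw [abs_neg]; exact abs_of_pos hδ))).1
  have l1 := Finset.sum_le_sum fun n (_ : n ∈ s) => sawtooth_ge hδ hδ1 (f n)
  have l2 := Finset.sum_le_sum fun n (_ : n ∈ s) => sawtooth_le hδ hδ1 (f n)
  rw [Finset.sum_sub_distrib, Finset.sum_const, ← Finset.mul_sum, nsmul_eq_mul] at l1
  rw [Finset.sum_add_distrib, Finset.sum_const, ← Finset.mul_sum, nsmul_eq_mul] at l2
  have e : ∑ n ∈ s, (bernoulliTwo (f n) - bernoulliTwo (f n - 1 / K))
      = -∑ n ∈ s, (bernoulliTwo (f n + -(1 / K)) - bernoulliTwo (f n)) := by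
    rw [← Finset.sum_neg_distrib]
    refine Finset.sum_congr rfl fun n _ => ?_
    rw [neg_sub, ← sub_eq_add_neg]
  rw [e] at l2
  have eM : 4 * M / Real.sqrt K = 2 * (1 / K) * (2 * M * Real.sqrt K) := by
    rw [← hsK2]; field_simp; rw [Real.sqrt_sq hsK.le]; ring
  have eC : (s.card : ℝ) * (1 / K) ^ 2 = 2 * (1 / K) * (s.card / (2 * K)) := by
    field_simp
  rw [eM] at h1 h2
  rw [eC] at l1 l2
  have hpos : (0 : ℝ) < 2 * (1 / K) := by positivity
  rw [abs_le]
  constructor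
  · refine le_of_mul_le_mul_left ?_ hpos
    linarith
  · refine le_of_mul_le_mul_left ?_ hpos
    linarith

theorem norm_sum_expCircle_div_le {x : ℝ} (hx : 0 < x) {D E : ℕ} (hD : 0 < D) (hDE : D ≤ E)
    (hE : E ≤ 3 * D) (hEx : (E : ℝ) ^ 2 ≤ x) {h : ℕ} (hh : 0 < h) :
    ‖∑ n ∈ Finset.Ico (D + 1) (E + 1), expCircle (h * (x / n))‖
      ≤ 84 * Real.sqrt (x / D) * Real.sqrt h := by
  have hD' : (0 : ℝ) < D := by exact_mod_cast hD
  have hDE' : (D : ℝ) ≤ E := by exact_mod_cast hDE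
  have hE' : (E : ℝ) ≤ 3 * D := by exact_mod_cast hE
  have hh' : (1 : ℝ) ≤ h := by exact_mod_cast hh
  set r := Real.sqrt (x / D) with hr
  set q := Real.sqrt (h : ℝ) with hq
  have hr0 : 0 < r := Real.sqrt_pos.2 (by positivity)
  have hq1 : 1 ≤ q := Real.one_le_sqrt.2 hh'
  have hqq : q * q = h := Real.mul_self_sqrt (by positivity)
  have hrr : r * r = x / D := Real.mul_self_sqrt (by positivity)
  have hrx : x = r * r * D := by rw [hrr]; field_simp
  have hDr : (D : ℝ) ≤ r * r := by
    rw [hrr, le_div_iff₀ hD']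
    nlinarith
  set lam : ℝ := (q * r / (4 * D)) ^ 2 with hlam
  have hlam0 : 0 < lam := by positivity
  have hsl : Real.sqrt lam = q * r / (4 * D) := Real.sqrt_sq (by positivity)
  rcases le_or_gt lam 1 with h1 | h1
  · have hv := van_der_corput (fun n : ℕ => h * (x / n)) hlam0 h1 (A := D + 1) (B := E + 1)
      (u := -(h * x / D ^ 2)) (V := h * x / D ^ 2) (by positivity) ?_ ?_
    · refine hv.trans ?_
      rw [hsl]
      have e : (h * x / (D : ℝ) ^ 2 + 2) * (7 / (q * r / (4 * D)))
          = 28 * (r * q) + 56 * (D / (q * r)) := by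
        rw [← hqq, hrx]
        field_simp
        ring
      rw [e]
      have : D / (q * r) ≤ r * q := by
        rw [div_le_iff₀ (by positivity)]
        have : 1 ≤ q * q := by nlinarith
        nlinarith [mul_pos hr0 hr0]
      linarith
    · intro n hn1 hn2
      have hn0 : (0 : ℝ) < n := by
        have : 0 < n := by omega
        exact_mod_cast this
      have hn3 : (n : ℝ) + 1 ≤ 3 * D := by
        have : n + 1 ≤ 3 * D := by omega
        exact_mod_cast this
      push_cast
      have e : (h * (x / ((n : ℝ) + 2)) - h * (x / ((n : ℝ) + 1)))
          = h * (x / ((n : ℝ) + 1)) - h * (x / n) + 2 * h * x / (n * (n + 1) * (n + 2)) := by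
        field_simp
        ring
      rw [e]
      gcongr
      have e2 : lam = h * x / (16 * D ^ 3) := by
        rw [hlam, ← hqq, hrx]
        field_simp
        norm_num
      rw [e2, div_le_div_iff₀ (by positivity) (by positivity)]
      have e3 : (n : ℝ) * (n + 1) * (n + 2) ≤ 27 * D ^ 3 := by
        have : (n : ℝ) * (n + 1) * (n + 2) ≤ (n + 1) ^ 3 := by nlinarith
        have h4 : ((n : ℝ) + 1) ^ 3 ≤ (3 * D) ^ 3 := by gcongr
        nlinarith
      have e4 : 0 ≤ h * x := by positivity
      have e5 : (0 : ℝ) ≤ D ^ 3 := by positivity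
      calc h * x * ((n : ℝ) * (n + 1) * (n + 2)) ≤ h * x * (27 * D ^ 3) := by gcongr
        _ ≤ 2 * h * x * (16 * D ^ 3) := by nlinarith
    · intro n hn
      obtain ⟨hn1, hn2⟩ := Finset.mem_Ico.1 hn
      have hn0 : (D : ℝ) ≤ n := by
        have : D ≤ n := by omega
        exact_mod_cast this
      have hn0' : (0 : ℝ) < n := by linarith
      push_cast
      have e : h * (x / ((n : ℝ) + 1)) - h * (x / n) = -(h * x / (n * (n + 1))) := by
        field_simp
        ring
      rw [e]
      have e1 : 0 ≤ h * x / ((n : ℝ) * (n + 1)) := by positivity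
      have e2 : h * x / ((n : ℝ) * (n + 1)) ≤ h * x / D ^ 2 := by
        gcongr
        nlinarith
      constructor <;> linarith
  · have h2 : 1 ≤ q * r / (4 * D) := by
      rw [← hsl]
      exact Real.one_le_sqrt.2 h1.le
    rw [le_div_iff₀ (by positivity)] at h2
    refine (norm_sum_le _ _).trans ?_
    simp only [norm_expCircle, Finset.sum_const, nsmul_eq_mul, mul_one, Nat.card_Ico]
    have h3 : ((E + 1 - (D + 1) : ℕ) : ℝ) ≤ E := by
      have : E + 1 - (D + 1) ≤ E := by omega
      exact_mod_cast this
    have h4 : 0 < q * r := by positivity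
    linarith

theorem abs_sum_sawtooth_div_block_le {x c : ℝ} (hc : 0 < c) (hcx : c ^ 3 = x) {D E : ℕ}
    (hD : 0 < D) (hDE : D ≤ E) (hE : E ≤ 3 * D) (hEx : (E : ℝ) ^ 2 ≤ x) :
    |∑ n ∈ Finset.Ico (D + 1) (E + 1), sawtooth (x / n)| ≤ 300 * c := by
  have hx : 0 < x := by rw [← hcx]; positivity
  have hD' : (0 : ℝ) < D := by exact_mod_cast hD
  have hcard : ((Finset.Ico (D + 1) (E + 1)).card : ℝ) ≤ 2 * D := by
    rw [Nat.card_Ico]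
    have : E + 1 - (D + 1) ≤ 2 * D := by omega
    exact_mod_cast this
  rcases le_or_gt (D : ℝ) c with h | h
  · refine (Finset.abs_sum_le_sum_abs _ _).trans
      ((Finset.sum_le_sum fun n _ => abs_sawtooth_le _).trans ?_)
    rw [Finset.sum_const, nsmul_eq_mul]
    linarith
  · set K := ⌈(D : ℝ) / c⌉₊ with hK
    have hK0 : 0 < K := Nat.ceil_pos.2 (by positivity)
    have hK1 : (D : ℝ) / c ≤ K := Nat.le_ceil _
    have hK2 : (K : ℝ) ≤ 2 * (D / c) := by
      have h1 : (K : ℝ) < D / c + 1 := Nat.ceil_lt_add_one (by positivity)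
      have h2 : 1 ≤ D / c := by rw [le_div_iff₀ hc]; linarith
      linarith
    have hK' : (0 : ℝ) < K := by exact_mod_cast hK0
    have hb := abs_sum_sawtooth_le (Finset.Ico (D + 1) (E + 1)) (fun n : ℕ => x / n)
      (M := 84 * Real.sqrt (x / D)) (by positivity) hK0
      (fun h hh => norm_sum_expCircle_div_le hx hD hDE hE hEx hh)
    refine hb.trans ?_
    have b1 : ((Finset.Ico (D + 1) (E + 1)).card : ℝ) / (2 * K) ≤ c := by
      rw [div_le_iff₀ (by positivity)]
      rw [div_le_iff₀ hc] at hK1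
      linarith
    have b2 : Real.sqrt (x / D) * Real.sqrt K ≤ 3 / 2 * c := by
      rw [← Real.sqrt_mul (by positivity)]
      refine Real.sqrt_le_iff.2 ⟨by positivity, ?_⟩
      calc x / D * K ≤ x / D * (2 * (D / c)) := by gcongr
        _ = 2 * c ^ 2 := by rw [← hcx]; field_simp
        _ ≤ (3 / 2 * c) ^ 2 := by nlinarith
    nlinarith

theorem abs_sum_sawtooth_div_le_log {x c : ℝ} (hc : 0 < c) (hc1 : 1 ≤ c) (hcx : c ^ 3 = x) (N : ℕ)
    (hN : (N : ℝ) ^ 2 ≤ x) :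
    |∑ n ∈ Finset.Ico 1 (N + 1), sawtooth (x / n)| ≤ 300 * c * (Nat.log 2 N + 1) := by
  induction N using Nat.strong_induction_on with
  | _ N ih =>
    rcases lt_or_ge N 2 with h | h
    · have : ((Finset.Ico 1 (N + 1)).card : ℝ) ≤ 1 := by
        rw [Nat.card_Ico]
        have : N + 1 - 1 ≤ 1 := by omega
        exact_mod_cast this
      refine (Finset.abs_sum_le_sum_abs _ _).trans
        ((Finset.sum_le_sum fun n _ => abs_sawtooth_le _).trans ?_)
      rw [Finset.sum_const, nsmul_eq_mul]
      have h0 : (0 : ℝ) ≤ Nat.log 2 N := Nat.cast_nonneg _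
      nlinarith
    · have hle : N / 2 ≤ N := Nat.div_le_self _ _
      have hhalf : ((N / 2 : ℕ) : ℝ) ^ 2 ≤ x := by
        refine le_trans ?_ hN
        gcongr
      have h1 := ih (N / 2) (by omega) hhalf
      have h2 := abs_sum_sawtooth_div_block_le hc hcx (D := N / 2) (E := N) (by omega) hle
        (by omega) hN
      have hlog : Nat.log 2 N = Nat.log 2 (N / 2) + 1 := Nat.log_of_one_lt_of_le one_lt_two h
      rw [← Finset.sum_Ico_consecutive _ (by omega : 1 ≤ N / 2 + 1)
        (by omega : N / 2 + 1 ≤ N + 1), hlog]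
      refine (abs_add_le _ _).trans ?_
      push_cast
      linarith

theorem natLog_two_add_one_le {x : ℝ} (hx : 3 ≤ x) {N : ℕ} (hN : (N : ℝ) ^ 2 ≤ x) :
    (Nat.log 2 N : ℝ) + 1 ≤ 3 * Real.log x := by
  have hlx : 1 ≤ Real.log x := by
    rw [Real.le_log_iff_exp_le (by linarith)]
    linarith [Real.exp_one_lt_d9]
  rcases Nat.eq_zero_or_pos N with rfl | hpos
  · simp; linarith
  have hN' : (0 : ℝ) < N := by exact_mod_cast hpos
  have h1 := Real.natLog_le_logb N 2
  rw [Real.logb] at h1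
  have hl2 := Real.log_two_gt_d9
  have h2 : 2 * Real.log N ≤ Real.log x := by
    have := Real.log_le_log (by positivity) hN
    rwa [Real.log_pow] at this
  have h3 : Real.log N / Real.log 2 ≤ Real.log x := by
    rw [div_le_iff₀ (by linarith)]
    nlinarith
  push_cast at h1
  linarith

/-- Voronoi's bound for the sawtooth sums of the divisor problem. -/
theorem abs_sum_sawtooth_div_le {x : ℝ} (hx : 3 ≤ x) (N : ℕ) (hN : (N : ℝ) ^ 2 ≤ x) :
    |∑ n ∈ Finset.Ico 1 (N + 1), sawtooth (x / n)|
      ≤ 900 * (x ^ ((1 : ℝ) / 3) * Real.log x) := by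
  have hx0 : 0 < x := by linarith
  have hc : 0 < x ^ ((1 : ℝ) / 3) := by positivity
  have hc1 : 1 ≤ x ^ ((1 : ℝ) / 3) := Real.one_le_rpow (by linarith) (by norm_num)
  have hcx : (x ^ ((1 : ℝ) / 3)) ^ 3 = x := by
    rw [← Real.rpow_natCast, ← Real.rpow_mul hx0.le]
    norm_num
  have h1 := abs_sum_sawtooth_div_le_log hc hc1 hcx N hN
  have h2 := natLog_two_add_one_le hx hN
  nlinarith

theorem sum_range_inv_succ_le (n : ℕ) :
    ∑ i ∈ Finset.range n, (1 : ℝ) / (i + 1 : ℕ) ≤ 1 + Real.log n := by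
  have h := harmonic_le_one_add_log n
  rw [harmonic] at h
  push_cast at h
  simpa only [one_div, Nat.cast_add, Nat.cast_one] using h

/-- Partial summation with a weight of slow variation. -/
theorem norm_sum_mul_le_of_slow_variation (g : ℕ → ℂ) (a : ℕ → ℝ) {N : ℕ} {B K : ℝ} (hK : 0 ≤ K)
    (ha : ∀ n ≤ N, |∑ i ∈ Finset.Ico 1 (n + 1), a i| ≤ B)
    (hg : ∀ n, 1 ≤ n → n ≤ N → ‖g n‖ ≤ 1)
    (hg' : ∀ n, 1 ≤ n → n < N → ‖g (n + 1) - g n‖ ≤ K * (1 / n)) :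
    ‖∑ i ∈ Finset.Ico 1 (N + 1), g i * a i‖ ≤ B * (1 + K * (1 + Real.log N)) := by
  have hB : 0 ≤ B := (abs_nonneg _).trans (ha 0 (Nat.zero_le _))
  set P : ℕ → ℂ := fun n => ((∑ i ∈ Finset.Ico 1 (n + 1), a i : ℝ) : ℂ) with hP
  have hPB : ∀ n ≤ N, ‖P n‖ ≤ B := fun n hn => by
    rw [hP, Complex.norm_real]
    exact ha n hn
  have abel : ∀ n, ∑ i ∈ Finset.Ico 1 (n + 2), g i * a i
      = g (n + 1) * P (n + 1) - ∑ i ∈ Finset.range n, P (i + 1) * (g (i + 2) - g (i + 1)) := by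
    intro n
    induction n with
    | zero => simp [hP]
    | succ n ih =>
      rw [Finset.sum_Ico_succ_top (by omega), ih, Finset.sum_range_succ]
      have : P (n + 2) = P (n + 1) + a (n + 2) := by
        simp only [hP]
        rw [Finset.sum_Ico_succ_top (by omega : 1 ≤ n + 2)]
        push_cast
        ring
      rw [show n + 1 + 1 = n + 2 by ring, this]
      ring
  rcases N with _ | N
  · simp only [zero_add, Finset.Ico_self, Finset.sum_empty, norm_zero, Nat.cast_zero, Real.log_zero,
      add_zero]
    positivity
  rw [abel]
  have h1 : ‖g (N + 1) * P (N + 1)‖ ≤ B := by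
    rw [norm_mul]
    calc _ ≤ 1 * B := mul_le_mul (hg _ (by omega) le_rfl) (hPB _ le_rfl) (norm_nonneg _) zero_le_one
      _ = B := one_mul B
  have h2 : ‖∑ i ∈ Finset.range N, P (i + 1) * (g (i + 2) - g (i + 1))‖
      ≤ B * (K * (1 + Real.log (N + 1 : ℕ))) := by
    calc _ ≤ ∑ i ∈ Finset.range N, B * (K * (1 / (i + 1 : ℕ))) := by
          refine (norm_sum_le _ _).trans (Finset.sum_le_sum fun i hi => ?_)
          rw [norm_mul]
          have hi' := Finset.mem_range.1 hi
          exact mul_le_mul (hPB _ (by omega)) (hg' (i + 1) (by omega) (by omega))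
            (norm_nonneg _) hB
      _ = B * (K * ∑ i ∈ Finset.range N, (1 : ℝ) / (i + 1 : ℕ)) := by
          rw [Finset.mul_sum, Finset.mul_sum]
      _ ≤ B * (K * (1 + Real.log N)) := by
          gcongr
          exact sum_range_inv_succ_le N
      _ ≤ _ := by
          rcases Nat.eq_zero_or_pos N with rfl | hN
          · simp
          · have : (0 : ℝ) < N := by exact_mod_cast hN
            gcongr
            linarith
  calc _ ≤ _ := norm_sub_le _ _
    _ ≤ _ := add_le_add h1 h2
    _ = _ := by ring

theorem hasDerivAt_ofReal_cpow {t : ℝ} (ht : 0 < t) (w : ℂ) :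
    HasDerivAt (fun u : ℝ => (u : ℂ) ^ w) (w * (t : ℂ) ^ (w - 1)) t := by
  have h := (hasDerivAt_id (t : ℂ)).cpow_const (c := w) (Or.inl (by simpa using ht))
  simpa using h.comp_ofReal

theorem norm_cpow_succ_sub_le {n : ℕ} (hn : 1 ≤ n) {w : ℂ} (hw : w.re ≤ 1) :
    ‖((n + 1 : ℕ) : ℂ) ^ w - (n : ℂ) ^ w‖ ≤ ‖w‖ * (n : ℝ) ^ (w.re - 1) := by
  have hn' : (0 : ℝ) < n := by exact_mod_cast hn
  have h := norm_image_sub_le_of_norm_deriv_le_segment' (a := (n : ℝ)) (b := n + 1)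
    (f := fun u : ℝ => (u : ℂ) ^ w) (f' := fun u => w * (u : ℂ) ^ (w - 1))
    (C := ‖w‖ * (n : ℝ) ^ (w.re - 1))
    (fun u hu => (hasDerivAt_ofReal_cpow (hn'.trans_le hu.1) w).hasDerivWithinAt)
    (fun u hu => by
      rw [norm_mul, Complex.norm_cpow_eq_rpow_re_of_pos (hn'.trans_le hu.1)]
      gcongr
      exact Real.rpow_le_rpow_of_nonpos hn' hu.1 (by simpa using hw))
    (n + 1) ⟨by linarith, le_rfl⟩
  simpa using h

/-- The trapezoidal approximation to `ζ(s)` of length `N`. -/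
noncomputable def zetaTrapezoid (s : ℂ) (N : ℕ) : ℂ :=
  ∑ n ∈ Finset.Icc 1 N, (n : ℂ) ^ (-s) - (N : ℂ) ^ (1 - s) / (1 - s) - (N : ℂ) ^ (-s) / 2

/-- The first-order Euler–Maclaurin primitive of `t ↦ t^{-s}` on a unit interval from `a`. -/
noncomputable def eulerMaclaurinPrimitive (s : ℂ) (a t : ℝ) : ℂ :=
  (t : ℂ) ^ (1 - s) / (1 - s) - ((t - a - 1 / 2 : ℝ) : ℂ) * (t : ℂ) ^ (-s)

theorem hasDerivAt_eulerMaclaurinPrimitive {s : ℂ} (hs : s ≠ 1) (a : ℝ) {t : ℝ} (ht : 0 < t) :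
    HasDerivAt (eulerMaclaurinPrimitive s a)
      (((t - a - 1 / 2 : ℝ) : ℂ) * (s * (t : ℂ) ^ (-s - 1))) t := by
  have hs' : 1 - s ≠ 0 := sub_ne_zero.2 hs.symm
  have h1 := (hasDerivAt_ofReal_cpow ht (1 - s)).div_const (1 - s)
  have h2 : HasDerivAt (fun u : ℝ => ((u - a - 1 / 2 : ℝ) : ℂ)) ((1 : ℝ) : ℂ) t :=
    (((hasDerivAt_id t).sub_const a).sub_const (1 / 2)).ofReal_comp
  have h3 := h1.sub (h2.mul (hasDerivAt_ofReal_cpow ht (-s)))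
  refine h3.congr_deriv ?_
  rw [show (1 : ℂ) - s - 1 = -s by ring]
  field_simp
  push_cast
  ring

theorem norm_eulerMaclaurinPrimitive_sub_le {s : ℂ} (hs : s ≠ 1) (hre : -1 ≤ s.re) {a t : ℝ}
    (ha : 0 < a) (hat : a ≤ t) (hta : t ≤ a + 1) :
    ‖eulerMaclaurinPrimitive s a t - eulerMaclaurinPrimitive s a a‖
      ≤ ‖s‖ * a ^ (-s.re - 1) := by
  have h := norm_image_sub_le_of_norm_deriv_le_segment' (a := a) (b := a + 1)
    (C := ‖s‖ * a ^ (-s.re - 1))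
    (fun u hu => (hasDerivAt_eulerMaclaurinPrimitive hs a (ha.trans_le hu.1)).hasDerivWithinAt)
    (fun u hu => by
      have hu0 : 0 < u := lt_of_lt_of_le (by assumption) hu.1
      have h1 : |u - a - 1 / 2| ≤ 1 := by
        rw [abs_le]
        constructor <;> linarith [hu.1, hu.2]
      rw [norm_mul, norm_mul, Complex.norm_cpow_eq_rpow_re_of_pos (ha.trans_le hu.1),
        Complex.norm_real, Real.norm_eq_abs]
      have h2 : u ^ (-s - 1).re ≤ a ^ (-s.re - 1) := by
        simpa using Real.rpow_le_rpow_of_nonpos ha hu.1 (by linarith : -s.re - 1 ≤ 0)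
      calc _ ≤ 1 * (‖s‖ * a ^ (-s.re - 1)) := by gcongr
        _ = _ := one_mul _)
    t ⟨hat, hta⟩
  refine h.trans (mul_le_of_le_one_right (by positivity) (by linarith))

theorem norm_zetaTrapezoid_succ_sub_le {s : ℂ} (hs : s ≠ 1) (hre : -2 ≤ s.re) {N : ℕ}
    (hN : 1 ≤ N) :
    ‖zetaTrapezoid s (N + 1) - zetaTrapezoid s N‖ ≤ ‖s‖ * ‖s + 1‖ * (N : ℝ) ^ (-s.re - 2) := by
  have hN' : (0 : ℝ) < N := by exact_mod_cast hN
  set a : ℝ := (N : ℝ) with ha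
  set E : ℝ → ℂ := fun t => eulerMaclaurinPrimitive s a t
    + ((((t - a) ^ 2 - (t - a)) / 2 : ℝ) : ℂ) * (-s * (t : ℂ) ^ (-s - 1)) with hE
  have hd : ∀ t : ℝ, 0 < t → HasDerivAt E
      (((((t - a) ^ 2 - (t - a)) / 2 : ℝ) : ℂ) * (s * (s + 1) * (t : ℂ) ^ (-s - 2))) t := by
    intro t ht
    have h1 := hasDerivAt_eulerMaclaurinPrimitive hs a ht
    have h2 : HasDerivAt (fun u : ℝ => ((((u - a) ^ 2 - (u - a)) / 2 : ℝ) : ℂ))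
        ((((2 * (t - a) - 1) / 2 : ℝ)) : ℂ) t := by
      have := ((((hasDerivAt_id t).sub_const a).pow 2).sub
        ((hasDerivAt_id t).sub_const a)).div_const 2
      refine (this.congr_deriv ?_).ofReal_comp
      simp
    have h3 := (hasDerivAt_ofReal_cpow ht (-s - 1)).const_mul (-s)
    have h4 := h1.add (h2.mul h3)
    refine h4.congr_deriv ?_
    rw [show -s - 1 - 1 = -s - 2 by ring]
    push_cast
    ring
  have h := norm_image_sub_le_of_norm_deriv_le_segment' (a := a) (b := a + 1)
    (C := ‖s‖ * ‖s + 1‖ * a ^ (-s.re - 2))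
    (fun u hu => (hd u (hN'.trans_le hu.1)).hasDerivWithinAt)
    (fun u hu => by
      have hu0 : 0 < u := lt_of_lt_of_le (by assumption) hu.1
      have h1 : |((u - a) ^ 2 - (u - a)) / 2| ≤ 1 := by
        have := hu.1
        have := hu.2
        rw [abs_le]
        constructor <;> nlinarith
      rw [norm_mul, norm_mul, norm_mul, Complex.norm_cpow_eq_rpow_re_of_pos (hN'.trans_le hu.1),
        Complex.norm_real, Real.norm_eq_abs]
      have h2 : u ^ (-s - 2).re ≤ a ^ (-s.re - 2) := by
        simpa using Real.rpow_le_rpow_of_nonpos hN' hu.1 (by linarith : -s.re - 2 ≤ 0)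
      calc _ ≤ 1 * (‖s‖ * ‖s + 1‖ * a ^ (-s.re - 2)) := by gcongr
        _ = _ := one_mul _)
    (a + 1) ⟨by linarith, le_rfl⟩
  have e : zetaTrapezoid s (N + 1) - zetaTrapezoid s N = -(E (a + 1) - E a) := by
    simp only [hE, eulerMaclaurinPrimitive, zetaTrapezoid, ha]
    rw [Finset.sum_Icc_succ_top (by omega)]
    push_cast
    ring
  rw [e, norm_neg]
  simpa using h

theorem tendsto_zetaTrapezoid_of_one_lt_re {s : ℂ} (hs : 1 < s.re) :
    Filter.Tendsto (fun N : ℕ => zetaTrapezoid s (N + 1)) Filter.atTop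
      (nhds (riemannZeta s)) := by
  have hpow : ∀ w : ℂ, w.re < 0 →
      Filter.Tendsto (fun N : ℕ => ((N : ℕ) : ℂ) ^ w) Filter.atTop (nhds 0) := by
    intro w hw
    rw [tendsto_zero_iff_norm_tendsto_zero]
    have h1 := (tendsto_rpow_neg_atTop (y := -w.re) (by linarith)).comp
      (tendsto_natCast_atTop_atTop (R := ℝ))
    refine h1.congr' ?_
    filter_upwards [Filter.eventually_ge_atTop 1] with N hN
    have hN' : (0 : ℝ) < N := by exact_mod_cast hN
    have := Complex.norm_cpow_eq_rpow_re_of_pos hN' w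
    rw [Function.comp_apply, neg_neg, ← this]
    simp
  have hsum : Filter.Tendsto (fun N : ℕ => ∑ n ∈ Finset.Icc 1 N, (n : ℂ) ^ (-s)) Filter.atTop
      (nhds (riemannZeta s)) := by
    have h1 : HasSum (fun n : ℕ => 1 / (n : ℂ) ^ s) (riemannZeta s) := by
      rw [zeta_eq_tsum_one_div_nat_cpow hs]
      exact (Complex.summable_one_div_nat_cpow.2 hs).hasSum
    have h2 := h1.tendsto_sum_nat.comp (Filter.tendsto_add_atTop_nat 1)
    refine h2.congr fun N => ?_
    rw [Function.comp_apply, Finset.range_eq_Ico, Finset.sum_eq_sum_Ico_succ_bot (by omega)]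
    have hs0 : s ≠ 0 := by
      rintro rfl
      simp at hs
      linarith
    rw [Nat.cast_zero, Complex.zero_cpow hs0, div_zero, zero_add]
    refine Finset.sum_congr (by ext; simp) fun n _ => ?_
    rw [Complex.cpow_neg, one_div]
  have h := (hsum.sub ((hpow (1 - s) (by simpa using hs)).div_const (1 - s))).sub
    ((hpow (-s) (by simp; linarith)).div_const 2)
  simp only [zero_div, sub_zero] at h
  exact h.comp (Filter.tendsto_add_atTop_nat 1)

theorem sub_one_mul_zetaTrapezoid {s : ℂ} (hs : s ≠ 1) (N : ℕ) :
    (s - 1) * zetaTrapezoid s N = (s - 1) * ∑ n ∈ Finset.Icc 1 N, (n : ℂ) ^ (-s)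
      + (N : ℂ) ^ (1 - s) - (s - 1) * ((N : ℂ) ^ (-s) / 2) := by
  have hs' : 1 - s ≠ 0 := sub_ne_zero.2 hs.symm
  rw [zetaTrapezoid]
  field_simp
  ring

theorem tendsto_zetaTrapezoid {s : ℂ} (hs : s ≠ 1) (hre : -(1 / 2) < s.re) :
    Filter.Tendsto (fun N : ℕ => zetaTrapezoid s (N + 1)) Filter.atTop
      (nhds (riemannZeta s)) := by
  set G : ℕ → ℂ → ℂ := fun N w => (w - 1) * ∑ n ∈ Finset.Icc 1 N, (n : ℂ) ^ (-w)
      + (N : ℂ) ^ (1 - w) - (w - 1) * ((N : ℂ) ^ (-w) / 2) with hG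
  set B : ℝ := ‖s‖ + 3 with hB
  set V : Set ℂ := {w | -(1 / 2) < w.re} ∩ Metric.ball 0 B with hV
  have hVo : IsOpen V := (isOpen_lt continuous_const Complex.continuous_re).inter Metric.isOpen_ball
  have hVc : Convex ℝ V := (convex_halfSpace_re_gt _).inter (convex_ball _ _)
  have hGd : ∀ N : ℕ, 1 ≤ N → Differentiable ℂ (G N) := by
    intro N hN
    have hp : ∀ n : ℕ, 1 ≤ n → ∀ g : ℂ → ℂ, Differentiable ℂ g →
        Differentiable ℂ (fun w => (n : ℂ) ^ (g w)) := fun n hn g hg =>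
      hg.const_cpow (Or.inl (by exact_mod_cast (by omega : n ≠ 0)))
    refine (((differentiable_id.sub_const 1).mul (Differentiable.fun_sum fun n hn => ?_)).add
      (hp N hN _ (by fun_prop))).sub ((differentiable_id.sub_const 1).mul
        ((hp N hN _ (by fun_prop)).div_const 2))
    exact hp n (Finset.mem_Icc.1 hn).1 _ (by fun_prop)
  have hbound : ∀ (n : ℕ) (w : ℂ), w ∈ V → ‖G (n + 2) w - G (n + 1) w‖
      ≤ (B + 1) ^ 3 * (1 / ((n + 1 : ℕ) : ℝ) ^ (3 / 2 : ℝ)) := by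
    intro n w hw
    have hw1 : -(1 / 2) < w.re := hw.1
    have hw2 : ‖w‖ < B := by simpa using hw.2
    rcases eq_or_ne w 1 with rfl | hw1'
    · simp only [hG, sub_self, zero_mul, Complex.cpow_zero, norm_zero]
      positivity
    · simp only [hG]
      rw [← sub_one_mul_zetaTrapezoid hw1', ← sub_one_mul_zetaTrapezoid hw1', ← mul_sub, norm_mul]
      have h1 := norm_zetaTrapezoid_succ_sub_le hw1' (by linarith) (N := n + 1) (by omega)
      have h2 : ‖w - 1‖ ≤ B + 1 := (norm_sub_le _ _).trans (by rw [norm_one]; linarith)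
      have h3 : ‖w + 1‖ ≤ B + 1 := (norm_add_le _ _).trans (by rw [norm_one]; linarith)
      have h4 : ((n + 1 : ℕ) : ℝ) ^ (-w.re - 2) ≤ 1 / ((n + 1 : ℕ) : ℝ) ^ (3 / 2 : ℝ) := by
        rw [one_div, ← Real.rpow_neg (by positivity)]
        apply Real.rpow_le_rpow_of_exponent_le
        · push_cast
          linarith [(Nat.cast_nonneg n : (0 : ℝ) ≤ n)]
        · linarith
      calc _ ≤ ‖w - 1‖ * (‖w‖ * ‖w + 1‖ * ((n + 1 : ℕ) : ℝ) ^ (-w.re - 2)) := by gcongr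
        _ ≤ (B + 1) * ((B + 1) * (B + 1) * (1 / ((n + 1 : ℕ) : ℝ) ^ (3 / 2 : ℝ))) := by
          gcongr
          linarith
        _ = _ := by ring
  have hsummable : Summable fun n : ℕ => (B + 1) ^ 3 * (1 / ((n + 1 : ℕ) : ℝ) ^ (3 / 2 : ℝ)) := by
    refine Summable.mul_left _ ?_
    exact (summable_nat_add_iff 1).2 (Real.summable_one_div_nat_rpow.2 (by norm_num))
  set T : ℂ → ℂ := fun w => G 1 w + ∑' n : ℕ, (G (n + 2) w - G (n + 1) w) with hT
  have hTd : DifferentiableOn ℂ T V := by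
    refine (hGd 1 le_rfl).differentiableOn.add
      (differentiableOn_tsum_of_summable_norm hsummable (fun n => ?_) hVo hbound)
    exact ((hGd _ (by omega)).sub (hGd _ (by omega))).differentiableOn
  have hlim : ∀ w ∈ V, Filter.Tendsto (fun N => G (N + 1) w) Filter.atTop (nhds (T w)) := by
    intro w hw
    have h1 := (Summable.of_norm_bounded hsummable (fun n => hbound n w hw)).hasSum.tendsto_sum_nat
    have h2 := h1.const_add (G 1 w)
    refine h2.congr fun N => ?_
    rw [Finset.sum_range_sub (fun n => G (n + 1) w)]
    ring
  have hGT : ∀ w, w ≠ 1 → ∀ N, G N w = (w - 1) * zetaTrapezoid w N := fun w hw N =>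
    (sub_one_mul_zetaTrapezoid hw N).symm
  have hζ : ∀ w, w ≠ 1 → riemannZeta₁ w = (w - 1) * riemannZeta w := by
    intro w hw
    rw [riemannZeta_eq_inv_sub_mul hw]
    field_simp [sub_ne_zero.2 hw]
  have h2V : (2 : ℂ) ∈ V := by
    refine ⟨by norm_num, ?_⟩
    have := norm_nonneg s
    simp [hB]
    linarith
  have hEq : Set.EqOn T riemannZeta₁ V := by
    refine AnalyticOnNhd.eqOn_of_preconnected_of_eventuallyEq (hTd.analyticOnNhd hVo)
      (differentiable_riemannZeta₁.differentiableOn.analyticOnNhd hVo) hVc.isPreconnected h2V ?_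
    have hopen : IsOpen {w : ℂ | 1 < w.re} := isOpen_lt continuous_const Complex.continuous_re
    filter_upwards [hVo.mem_nhds h2V, hopen.mem_nhds (by norm_num : (1 : ℝ) < (2 : ℂ).re)]
      with w hw1 hw2
    have hw3 : w ≠ 1 := by
      rintro rfl
      simp at hw2
    refine tendsto_nhds_unique (hlim w hw1) ?_
    rw [hζ w hw3]
    simp only [hGT w hw3]
    exact (tendsto_zetaTrapezoid_of_one_lt_re hw2).const_mul _
  have hsV : s ∈ V := ⟨hre, by simp [hB]⟩
  have h := hlim s hsV
  rw [hEq hsV, hζ s hs] at h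
  simp only [hGT s hs] at h
  have h' := h.const_mul (s - 1)⁻¹
  have hs' : s - 1 ≠ 0 := sub_ne_zero.2 hs
  simpa only [inv_mul_cancel_left₀ hs'] using h'

theorem norm_riemannZeta_sub_zetaTrapezoid_le {s : ℂ} (hs : s ≠ 1) (hre : 0 ≤ s.re) {N : ℕ}
    (hN : 1 ≤ N) :
    ‖riemannZeta s - zetaTrapezoid s N‖ ≤ 2 * (‖s‖ * ‖s + 1‖) * (N : ℝ) ^ (-s.re - 1) := by
  have hN' : (0 : ℝ) < N := by exact_mod_cast hN
  set C := ‖s‖ * ‖s + 1‖ * (N : ℝ) ^ (-s.re) with hC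
  have hC0 : 0 ≤ C := by positivity
  have hfin : ∀ k : ℕ, ‖zetaTrapezoid s (N + k) - zetaTrapezoid s N‖
      ≤ 2 * C * (1 / N - 1 / (N + k : ℕ)) := by
    intro k
    induction k with
    | zero => simp
    | succ k ih =>
      have h1 := norm_zetaTrapezoid_succ_sub_le hs (by linarith) (N := N + k) (by omega)
      have hNk : (1 : ℝ) ≤ (N + k : ℕ) := by exact_mod_cast (by omega : 1 ≤ N + k)
      have hNk2 : (N : ℝ) ≤ (N + k : ℕ) := by exact_mod_cast (by omega : N ≤ N + k)
      have h2 : ((N + k : ℕ) : ℝ) ^ (-s.re - 2)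
          ≤ (N : ℝ) ^ (-s.re) * (2 * (1 / (N + k : ℕ) - 1 / (N + (k + 1) : ℕ))) := by
        rw [Real.rpow_sub (by linarith), div_eq_mul_inv]
        have e : ((N + (k + 1) : ℕ) : ℝ) = (N + k : ℕ) + 1 := by push_cast; ring
        rw [e]
        generalize ((N + k : ℕ) : ℝ) = m at *
        have h3 : m ^ (-s.re) ≤ (N : ℝ) ^ (-s.re) :=
          Real.rpow_le_rpow_of_nonpos hN' hNk2 (by linarith)
        gcongr
        rw [div_sub_div _ _ (by linarith) (by linarith), Real.rpow_two, ← one_div, ← mul_div_assoc,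
          div_le_div_iff₀ (by positivity) (by positivity)]
        nlinarith
      have h5 : ‖s‖ * ‖s + 1‖ * ((N + k : ℕ) : ℝ) ^ (-s.re - 2)
          ≤ 2 * C * (1 / (N + k : ℕ) - 1 / (N + (k + 1) : ℕ)) := by
        calc _ ≤ ‖s‖ * ‖s + 1‖
              * ((N : ℝ) ^ (-s.re) * (2 * (1 / (N + k : ℕ) - 1 / (N + (k + 1) : ℕ)))) := by gcongr
          _ = _ := by rw [hC]; ring
      calc _ ≤ ‖zetaTrapezoid s (N + k + 1) - zetaTrapezoid s (N + k)‖
            + ‖zetaTrapezoid s (N + k) - zetaTrapezoid s N‖ := norm_sub_le_norm_sub_add_norm_sub _ _ _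
        _ ≤ 2 * C * (1 / (N + k : ℕ) - 1 / (N + (k + 1) : ℕ))
            + 2 * C * (1 / N - 1 / (N + k : ℕ)) := add_le_add (h1.trans h5) ih
        _ = _ := by ring
  have hl : Filter.Tendsto (fun k : ℕ => ‖zetaTrapezoid s (N + k) - zetaTrapezoid s N‖)
      Filter.atTop (nhds ‖riemannZeta s - zetaTrapezoid s N‖) := by
    have h1 := (tendsto_zetaTrapezoid hs (by linarith)).comp (Filter.tendsto_add_atTop_nat (N - 1))
    refine ((h1.congr fun k => ?_).sub_const _).norm
    rw [Function.comp_apply]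
    congr 1
    omega
  have hb : ∀ k : ℕ, ‖zetaTrapezoid s (N + k) - zetaTrapezoid s N‖ ≤ 2 * C * (1 / N) := by
    intro k
    refine (hfin k).trans ?_
    gcongr
    have : (0 : ℝ) ≤ 1 / (N + k : ℕ) := by positivity
    linarith
  refine (le_of_tendsto' hl hb).trans (le_of_eq ?_)
  rw [hC, Real.rpow_sub_one hN'.ne']
  ring

/-- Euler–Maclaurin asymptotics of the partial sums of the zeta series. -/
theorem exists_norm_sum_cpow_neg_sub_le {s : ℂ} (hs : s ≠ 1) (hre : 0 ≤ s.re) :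
    ∃ K ≥ 0, ∀ y : ℝ, 1 ≤ y →
      ‖∑ n ∈ Finset.Icc 1 ⌊y⌋₊, (n : ℂ) ^ (-s) - ((y : ℂ) ^ (1 - s) / (1 - s) + riemannZeta s
        - sawtooth y * (y : ℂ) ^ (-s))‖ ≤ K * y ^ (-s.re - 1) := by
  refine ⟨(2 * (‖s‖ * ‖s + 1‖) + ‖s‖) * (2 : ℝ) ^ (s.re + 1), by positivity, fun y hy => ?_⟩
  set N := ⌊y⌋₊ with hN
  have hN1 : 1 ≤ N := Nat.le_floor (by simpa using hy)
  have hN' : (0 : ℝ) < N := by exact_mod_cast hN1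
  have hNy : (N : ℝ) ≤ y := Nat.floor_le (by linarith)
  have hyN : y < N + 1 := Nat.lt_floor_add_one y
  have h1 := norm_riemannZeta_sub_zetaTrapezoid_le hs hre hN1
  have h2 := norm_eulerMaclaurinPrimitive_sub_le hs (by linarith) hN' hNy hyN.le
  have hfr : sawtooth y = y - N - 1 / 2 := by
    rw [sawtooth, ← Int.self_sub_floor, hN, natCast_floor_eq_intCast_floor (by linarith)]
  have e : ∑ n ∈ Finset.Icc 1 N, (n : ℂ) ^ (-s) - ((y : ℂ) ^ (1 - s) / (1 - s) + riemannZeta s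
        - sawtooth y * (y : ℂ) ^ (-s))
      = -(riemannZeta s - zetaTrapezoid s N)
        - (eulerMaclaurinPrimitive s N y - eulerMaclaurinPrimitive s N N) := by
    rw [eulerMaclaurinPrimitive, eulerMaclaurinPrimitive, zetaTrapezoid, hfr]
    push_cast
    ring
  have h3 : (N : ℝ) ^ (-s.re - 1) ≤ (2 : ℝ) ^ (s.re + 1) * y ^ (-s.re - 1) := by
    have : (N : ℝ) ^ (-s.re - 1) ≤ (y / 2) ^ (-s.re - 1) := by
      have hN1' : (1 : ℝ) ≤ N := by exact_mod_cast hN1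
      exact Real.rpow_le_rpow_of_nonpos (by linarith) (by linarith) (by linarith)
    refine this.trans (le_of_eq ?_)
    rw [Real.div_rpow (by linarith) (by norm_num), div_eq_mul_inv, ← Real.rpow_neg (by norm_num),
      mul_comm]
    congr 2
    ring
  rw [e]
  calc _ ≤ ‖riemannZeta s - zetaTrapezoid s N‖
        + ‖eulerMaclaurinPrimitive s N y - eulerMaclaurinPrimitive s N N‖ := by
        refine (norm_sub_le _ _).trans_eq ?_
        rw [norm_neg]
    _ ≤ (2 * (‖s‖ * ‖s + 1‖) + ‖s‖) * (N : ℝ) ^ (-s.re - 1) := by linarith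
    _ ≤ (2 * (‖s‖ * ‖s + 1‖) + ‖s‖) * ((2 : ℝ) ^ (s.re + 1) * y ^ (-s.re - 1)) := by gcongr
    _ = _ := by ring

theorem sum_sum_filter_pow_dvd (f : ℕ → ℂ) {β : ℕ} (hβ : β ≠ 0) (M : ℕ) :
    ∑ n ∈ Finset.Icc 1 M, ∑ d ∈ (Finset.Icc 1 n).filter (fun d => d ^ β ∣ n), f d
      = ∑ d ∈ Finset.Icc 1 M, f d * (M / d ^ β : ℕ) := by
  have h1 : ∀ n ∈ Finset.Icc 1 M, ∑ d ∈ (Finset.Icc 1 n).filter (fun d => d ^ β ∣ n), f d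
      = ∑ d ∈ Finset.Icc 1 M, if d ^ β ∣ n then f d else 0 := by
    intro n hn
    rw [← Finset.sum_filter]
    refine Finset.sum_congr ?_ fun _ _ => rfl
    ext d
    simp only [Finset.mem_filter, Finset.mem_Icc] at hn ⊢
    refine ⟨fun h => ⟨⟨h.1.1, by omega⟩, h.2⟩, fun h => ⟨⟨h.1.1, ?_⟩, h.2⟩⟩
    exact (Nat.le_self_pow hβ d).trans (Nat.le_of_dvd (by omega) h.2)
  rw [Finset.sum_congr rfl h1, Finset.sum_comm]
  refine Finset.sum_congr rfl fun d _ => ?_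
  rw [← Finset.sum_filter, Finset.sum_const, nsmul_eq_mul, mul_comm]
  congr 2
  rw [← Nat.Ioc_filter_dvd_card_eq_div]
  rfl

/-- Dirichlet's hyperbola method for sums over pairs `(d, m)` with `d ^ β * m ≤ M`. -/
theorem sum_mul_div_pow_hyperbola (f : ℕ → ℂ) {β M N : ℕ}
    (hN : N ^ (β + 1) ≤ M) (hM : M < (N + 1) ^ (β + 1)) :
    ∑ d ∈ Finset.Icc 1 M, f d * (M / d ^ β : ℕ)
      = ∑ d ∈ Finset.Icc 1 N, f d * (M / d ^ β : ℕ)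
        + ∑ m ∈ Finset.Icc 1 N, ∑ d ∈ (Finset.Icc 1 M).filter (fun d => d ^ β * m ≤ M), f d
        - N * ∑ d ∈ Finset.Icc 1 N, f d := by
  have hNM : N ≤ M := (Nat.le_self_pow (by omega) N).trans hN
  have hsplit : ∀ g : ℕ → ℂ, ∑ d ∈ Finset.Icc 1 M, g d
      = ∑ d ∈ Finset.Icc 1 N, g d + ∑ d ∈ Finset.Ioc N M, g d := by
    intro g
    rw [← Finset.sum_union]
    · refine Finset.sum_congr ?_ fun _ _ => rfl
      ext d
      simp only [Finset.mem_union, Finset.mem_Icc, Finset.mem_Ioc]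
      omega
    · rw [Finset.disjoint_left]
      intro d
      simp only [Finset.mem_Icc, Finset.mem_Ioc]
      omega
  have hlarge : ∀ d ∈ Finset.Ioc N M, f d * (M / d ^ β : ℕ)
      = ∑ m ∈ Finset.Icc 1 N, if d ^ β * m ≤ M then f d else 0 := by
    intro d hd
    rw [Finset.mem_Ioc] at hd
    have hd0 : 0 < d ^ β := pow_pos (by omega) _
    rw [← Finset.sum_filter, Finset.sum_const, nsmul_eq_mul, mul_comm]
    congr 2
    have : (Finset.Icc 1 N).filter (fun m => d ^ β * m ≤ M) = Finset.Icc 1 (M / d ^ β) := by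
      ext m
      simp only [Finset.mem_filter, Finset.mem_Icc, Nat.le_div_iff_mul_le hd0, mul_comm m]
      refine ⟨fun h => ⟨h.1.1, h.2⟩, fun h => ⟨⟨h.1, ?_⟩, h.2⟩⟩
      by_contra! hm
      have : (N + 1) ^ (β + 1) ≤ d ^ β * m := by
        rw [pow_succ]
        exact Nat.mul_le_mul (Nat.pow_le_pow_left hd.1 _) hm
      omega
    rw [this, Nat.card_Icc, Nat.add_sub_cancel]
  have hsmall : ∀ m ∈ Finset.Icc 1 N,
      ∑ d ∈ (Finset.Icc 1 M).filter (fun d => d ^ β * m ≤ M), f d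
        = ∑ d ∈ Finset.Icc 1 N, f d + ∑ d ∈ Finset.Ioc N M, if d ^ β * m ≤ M then f d else 0 := by
    intro m hm
    rw [Finset.sum_filter, hsplit]
    congr 1
    refine Finset.sum_congr rfl fun d hd => if_pos ?_
    rw [Finset.mem_Icc] at hm hd
    refine le_trans ?_ hN
    rw [pow_succ]
    exact Nat.mul_le_mul (Nat.pow_le_pow_left hd.2 _) hm.2
  rw [hsplit, Finset.sum_congr rfl hlarge, Finset.sum_congr rfl hsmall, Finset.sum_comm,
    Finset.sum_add_distrib, Finset.sum_const, Nat.card_Icc, nsmul_eq_mul]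
  simp only [Nat.add_sub_cancel]
  ring

theorem natCast_floor_eq_sub_sawtooth {t : ℝ} (ht : 0 ≤ t) :
    (⌊t⌋₊ : ℝ) = t - 1 / 2 - sawtooth t := by
  rw [sawtooth, ← Int.self_sub_floor, natCast_floor_eq_intCast_floor ht]
  ring

theorem filter_pow_mul_le_eq_Icc {β m : ℕ} (hβ : β ≠ 0) (hm : m ≠ 0) {x : ℝ} (hx : 0 ≤ x) :
    (Finset.Icc 1 ⌊x⌋₊).filter (fun d => d ^ β * m ≤ ⌊x⌋₊)
      = Finset.Icc 1 ⌊(x / m) ^ (1 / (β : ℝ))⌋₊ := by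
  have hm' : (0 : ℝ) < m := by exact_mod_cast Nat.pos_of_ne_zero hm
  ext d
  have key : d ^ β * m ≤ ⌊x⌋₊ ↔ d ≤ ⌊(x / m) ^ (1 / (β : ℝ))⌋₊ := by
    rw [Nat.le_floor_iff hx, Nat.le_floor_iff (by positivity), one_div,
      Real.le_rpow_inv_iff_of_pos (by positivity) (by positivity)
        (by exact_mod_cast Nat.pos_of_ne_zero hβ), Real.rpow_natCast, le_div_iff₀ hm']
    push_cast
    rfl
  simp only [Finset.mem_filter, Finset.mem_Icc, key]
  refine ⟨fun h => ⟨h.1.1, h.2⟩, fun h => ⟨⟨h.1, ?_⟩, h.2⟩⟩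
  exact (Nat.le_self_pow hβ d).trans
    ((Nat.le_mul_of_pos_right _ (Nat.pos_of_ne_zero hm)).trans (key.2 h.2))

theorem ofReal_cpow_eq_exp {r : ℝ} (hr : 0 < r) (u : ℂ) :
    (r : ℂ) ^ u = Complex.exp (Real.log r * u) := by
  rw [Complex.cpow_def_of_ne_zero (by exact_mod_cast hr.ne'), Complex.ofReal_log hr.le]

/-- Partial sums of `σ_{z,β}` after the hyperbola method, in terms of floors and power sums. -/
theorem sum_sigmaGen_eq (z : ℂ) {β : ℕ} (hβ : β ≠ 0) {Y : ℝ} (hY : 1 ≤ Y) :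
    ∑ n ∈ Finset.Icc 1 ⌊Y ^ (β + 1)⌋₊, sigmaGen z β n
      = Y ^ (β + 1) * ∑ d ∈ Finset.Icc 1 ⌊Y⌋₊, (d : ℂ) ^ (-(β * (1 - z)))
        - ∑ d ∈ Finset.Icc 1 ⌊Y⌋₊, (d : ℂ) ^ (β * z) * sawtooth (Y ^ (β + 1) / d ^ β)
        + ∑ m ∈ Finset.Icc 1 ⌊Y⌋₊,
            ∑ d ∈ Finset.Icc 1 ⌊(Y ^ (β + 1) / m) ^ (1 / (β : ℝ))⌋₊, (d : ℂ) ^ (β * z)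
        - (Y - sawtooth Y) * ∑ d ∈ Finset.Icc 1 ⌊Y⌋₊, (d : ℂ) ^ (β * z) := by
  have hY0 : 0 < Y := by linarith
  have hN : ⌊Y⌋₊ ^ (β + 1) ≤ ⌊Y ^ (β + 1)⌋₊ := by
    refine Nat.le_floor ?_
    push_cast
    exact pow_le_pow_left₀ (by positivity) (Nat.floor_le hY0.le) _
  have hM : ⌊Y ^ (β + 1)⌋₊ < (⌊Y⌋₊ + 1) ^ (β + 1) := by
    rw [Nat.floor_lt (by positivity)]
    push_cast
    exact pow_lt_pow_left₀ (Nat.lt_floor_add_one Y) hY0.le (by omega)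
  have hfl := natCast_floor_eq_sub_sawtooth hY0.le
  have hfl' : ((⌊Y⌋₊ : ℕ) : ℂ) = Y - 1 / 2 - sawtooth Y := by
    rw [← Complex.ofReal_natCast, hfl]
    push_cast
    rfl
  have h0 : ∀ m ∈ Finset.Icc 1 ⌊Y⌋₊,
      ∑ d ∈ (Finset.Icc 1 ⌊Y ^ (β + 1)⌋₊).filter (fun d => d ^ β * m ≤ ⌊Y ^ (β + 1)⌋₊),
        (d : ℂ) ^ (β * z)
      = ∑ d ∈ Finset.Icc 1 ⌊(Y ^ (β + 1) / m) ^ (1 / (β : ℝ))⌋₊, (d : ℂ) ^ (β * z) := by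
    intro m hm
    rw [Finset.mem_Icc] at hm
    rw [filter_pow_mul_le_eq_Icc hβ (by omega) (by positivity)]
  simp only [sigmaGen]
  rw [sum_sum_filter_pow_dvd _ hβ, sum_mul_div_pow_hyperbola _ hN hM, Finset.sum_congr rfl h0]
  have h1 : ∀ d ∈ Finset.Icc 1 ⌊Y⌋₊, (d : ℂ) ^ (β * z) * ((⌊Y ^ (β + 1)⌋₊ / d ^ β : ℕ) : ℂ)
      = Y ^ (β + 1) * (d : ℂ) ^ (-(β * (1 - z))) - 1 / 2 * (d : ℂ) ^ (β * z)
        - (d : ℂ) ^ (β * z) * sawtooth (Y ^ (β + 1) / d ^ β) := by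
    intro d hd
    have hd0 : (d : ℂ) ≠ 0 := by
      rw [Finset.mem_Icc] at hd
      exact_mod_cast (by omega : d ≠ 0)
    have h2 : (((⌊Y ^ (β + 1)⌋₊ / d ^ β : ℕ) : ℝ)) = Y ^ (β + 1) / d ^ β - 1 / 2
        - sawtooth (Y ^ (β + 1) / d ^ β) := by
      rw [← natCast_floor_eq_sub_sawtooth (by positivity), ← Nat.cast_pow, Nat.floor_div_natCast]
    rw [← Complex.ofReal_natCast (_ / _), h2,
      show -(β * (1 - z)) = β * z - (β : ℂ) by ring, Complex.cpow_sub _ _ hd0,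
      Complex.cpow_natCast]
    push_cast
    ring
  rw [Finset.sum_congr rfl h1, Finset.sum_sub_distrib, Finset.sum_sub_distrib, ← Finset.mul_sum,
    ← Finset.mul_sum, hfl']
  ring

/-- The hyperbola method for `σ_{z,β}`: up to `O(1)` the error term consists of two sawtooth sums
of length `x ^ (1 / (β + 1))`, where `x = Y ^ (β + 1)`. -/
theorem exists_norm_sum_sigmaGen_sub_le {z : ℂ} {β : ℕ} (hβ : β ≠ 0) (h1 : -1 < β * z.re)
    (h2 : z.re ≤ 0) (h3 : (1 + β * z : ℂ) ≠ β) :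
    ∃ K ≥ 0, ∀ Y : ℝ, 1 ≤ Y →
      ‖∑ n ∈ Finset.Icc 1 ⌊Y ^ (β + 1)⌋₊, sigmaGen z β n
          - riemannZeta (β * (1 - z)) * (Y ^ (β + 1) : ℝ)
          - riemannZeta (z + 1 / β) * ((Y ^ (β + 1) : ℝ) : ℂ) ^ (z + 1 / β) / (1 + β * z)
          + ∑ d ∈ Finset.Icc 1 ⌊Y⌋₊, (d : ℂ) ^ (β * z) * sawtooth (Y ^ (β + 1) / d ^ β)
          + ∑ m ∈ Finset.Icc 1 ⌊Y⌋₊, (((Y ^ (β + 1) / m) ^ (1 / (β : ℝ)) : ℝ) : ℂ) ^ (β * z)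
              * sawtooth ((Y ^ (β + 1) / m) ^ (1 / (β : ℝ)))‖ ≤ K := by
  have hβC : (β : ℂ) ≠ 0 := by exact_mod_cast hβ
  have hβR : (0 : ℝ) < β := by exact_mod_cast Nat.pos_of_ne_zero hβ
  have hwre : ((β : ℂ) * z).re = β * z.re := by simp
  have hw0 : (β : ℝ) * z.re ≤ 0 := mul_nonpos_of_nonneg_of_nonpos hβR.le h2
  have ha : (1 + β * z : ℂ) ≠ 0 := by
    intro h
    have := congrArg Complex.re h
    rw [Complex.add_re, hwre, Complex.one_re, Complex.zero_re] at this
    linarith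
  have hsre : (z + 1 / (β : ℂ)).re = (1 + β * z.re) / β := by
    rw [show z + 1 / (β : ℂ) = (1 + β * z) / (β : ℝ) by push_cast; field_simp; ring,
      Complex.div_ofReal_re, Complex.add_re, hwre, Complex.one_re]
  have hsub : (β : ℂ) - (1 + β * z) ≠ 0 := sub_ne_zero.2 h3.symm
  have hs1 : (β : ℂ) * (1 - z) ≠ 1 := fun h => hsub (by linear_combination h)
  have hs2 : z + 1 / (β : ℂ) ≠ 1 := by
    intro h
    apply hsub
    field_simp at h
    linear_combination -h
  have hs3 : -((β : ℂ) * z) ≠ 1 := fun h => ha (by linear_combination -h)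
  obtain ⟨K₁, hK₁, H₁⟩ := exists_norm_sum_cpow_neg_sub_le hs1
    (by rw [mul_one_sub, Complex.sub_re, hwre]; simp; nlinarith)
  obtain ⟨K₂, hK₂, H₂⟩ := exists_norm_sum_cpow_neg_sub_le hs3 (by rw [Complex.neg_re, hwre]; linarith)
  obtain ⟨K₃, hK₃, H₃⟩ := exists_norm_sum_cpow_neg_sub_le hs2
    (by rw [hsre]; exact div_nonneg (by linarith) hβR.le)
  have hre1 : ((β : ℂ) * (1 - z)).re = β - β * z.re := by
    rw [mul_one_sub, Complex.sub_re, hwre, Complex.natCast_re]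
  simp only [hre1, hsre, Complex.neg_re, hwre, neg_neg, sub_neg_eq_add] at H₁ H₂ H₃
  refine ⟨K₁ + 2 * K₂ + K₂ + K₃ / ‖1 + β * z‖ + 1 + ‖riemannZeta (-(β * z))‖, by positivity,
    fun Y hY => ?_⟩
  have hY0 : 0 < Y := by linarith
  have hYC : (Y : ℂ) ≠ 0 := by exact_mod_cast hY0.ne'
  have hNY : ((⌊Y⌋₊ : ℕ) : ℝ) ≤ Y := Nat.floor_le hY0.le
  set y : ℕ → ℝ := fun m => (Y ^ (β + 1) / m) ^ (1 / (β : ℝ)) with hy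
  have hYy : ∀ m ∈ Finset.Icc 1 ⌊Y⌋₊, Y ≤ y m := by
    intro m hm
    rw [Finset.mem_Icc] at hm
    have hm0 : (0 : ℝ) < m := by exact_mod_cast hm.1
    have hmY : (m : ℝ) ≤ Y := le_trans (by exact_mod_cast hm.2) hNY
    simp only [hy]
    rw [one_div, Real.le_rpow_inv_iff_of_pos hY0.le (by positivity) hβR, Real.rpow_natCast,
      le_div_iff₀ hm0, pow_succ]
    gcongr
  set R₁ := ∑ n ∈ Finset.Icc 1 ⌊Y⌋₊, (n : ℂ) ^ (-(β * (1 - z)))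
    - ((Y : ℂ) ^ (1 - β * (1 - z)) / (1 - β * (1 - z)) + riemannZeta (β * (1 - z))
      - sawtooth Y * (Y : ℂ) ^ (-(β * (1 - z)))) with hR₁
  set R₂ : ℝ → ℂ := fun t => ∑ n ∈ Finset.Icc 1 ⌊t⌋₊, (n : ℂ) ^ (β * z)
    - ((t : ℂ) ^ (1 + β * z) / (1 + β * z) + riemannZeta (-(β * z))
      - sawtooth t * (t : ℂ) ^ (β * z)) with hR₂
  set R₃ := ∑ n ∈ Finset.Icc 1 ⌊Y⌋₊, (n : ℂ) ^ (-(z + 1 / β))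
    - ((Y : ℂ) ^ (1 - (z + 1 / β)) / (1 - (z + 1 / β)) + riemannZeta (z + 1 / β)
      - sawtooth Y * (Y : ℂ) ^ (-(z + 1 / β))) with hR₃
  have B₁ : ‖(Y : ℂ) ^ (β + 1) * R₁‖ ≤ K₁ := by
    have h : Y ^ (β + 1) * (K₁ * Y ^ (-(β - β * z.re) - 1)) = K₁ * Y ^ (β * z.re) := by
      rw [← Real.rpow_natCast, mul_left_comm, ← Real.rpow_add hY0]
      congr 2
      push_cast
      ring
    rw [norm_mul, norm_pow, Complex.norm_real, Real.norm_of_nonneg hY0.le]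
    calc _ ≤ Y ^ (β + 1) * (K₁ * Y ^ (-(β - β * z.re) - 1)) := by gcongr; exact H₁ Y hY
      _ = K₁ * Y ^ (β * z.re) := h
      _ ≤ K₁ * 1 := by gcongr; exact Real.rpow_le_one_of_one_le_of_nonpos hY hw0
      _ = K₁ := mul_one _
  have hR₂le : ∀ t : ℝ, Y ≤ t → ‖R₂ t‖ ≤ K₂ * Y⁻¹ := by
    intro t ht
    refine (H₂ t (hY.trans ht)).trans ?_
    rw [← Real.rpow_neg_one Y]
    have h4 : t ^ (β * z.re - 1) ≤ Y ^ (β * z.re - 1) :=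
      Real.rpow_le_rpow_of_nonpos hY0 ht (by linarith)
    have h5 : Y ^ (β * z.re - 1) ≤ Y ^ (-1 : ℝ) :=
      Real.rpow_le_rpow_of_exponent_le hY (by linarith)
    gcongr
    exact h4.trans h5
  have hsaw : |sawtooth Y| ≤ 1 / 2 := abs_sawtooth_le Y
  have B₂ : ‖((Y - sawtooth Y : ℝ) : ℂ) * R₂ Y‖ ≤ 2 * K₂ := by
    rw [norm_mul, Complex.norm_real, Real.norm_eq_abs]
    have h4 : |Y - sawtooth Y| ≤ 2 * Y := by
      rw [abs_le] at hsaw ⊢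
      constructor <;> linarith
    calc _ ≤ 2 * Y * (K₂ * Y⁻¹) := by gcongr; exact hR₂le Y le_rfl
      _ = 2 * K₂ := by field_simp
  have B₂' : ‖∑ m ∈ Finset.Icc 1 ⌊Y⌋₊, R₂ (y m)‖ ≤ K₂ := by
    calc _ ≤ ∑ m ∈ Finset.Icc 1 ⌊Y⌋₊, K₂ * Y⁻¹ := norm_sum_le_of_le _ fun m hm =>
          hR₂le _ (hYy m hm)
      _ = ⌊Y⌋₊ * (K₂ * Y⁻¹) := by simp
      _ ≤ Y * (K₂ * Y⁻¹) := by gcongr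
      _ = K₂ := by field_simp
  have hlogx : Real.log (Y ^ (β + 1)) = (β + 1) * Real.log Y := by
    rw [Real.log_pow]
    push_cast
    rfl
  have B₃ : ‖((Y ^ (β + 1) : ℝ) : ℂ) ^ (z + 1 / β) / (1 + β * z) * R₃‖
      ≤ K₃ / ‖1 + β * z‖ := by
    have h : (Y ^ (β + 1)) ^ ((1 + β * z.re) / β) * Y ^ (-((1 + β * z.re) / β) - 1)
        = Y ^ (β * z.re) := by
      rw [← Real.rpow_natCast, ← Real.rpow_mul hY0.le, ← Real.rpow_add hY0]
      congr 1
      push_cast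
      field_simp
      ring
    rw [norm_mul, norm_div, Complex.norm_cpow_eq_rpow_re_of_pos (by positivity), hsre]
    calc _ ≤ (Y ^ (β + 1)) ^ ((1 + β * z.re) / β) / ‖1 + β * z‖
          * (K₃ * Y ^ (-((1 + β * z.re) / β) - 1)) := by gcongr; exact H₃ Y hY
      _ = K₃ / ‖1 + β * z‖ * Y ^ (β * z.re) := by rw [← h]; ring
      _ ≤ K₃ / ‖1 + β * z‖ * 1 := by
        gcongr
        exact Real.rpow_le_one_of_one_le_of_nonpos hY hw0
      _ = _ := mul_one _
  have B₄ : ‖((sawtooth Y ^ 2 : ℝ) : ℂ) * (Y : ℂ) ^ (β * z)‖ ≤ 1 := by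
    rw [norm_mul, Complex.norm_real, Complex.norm_cpow_eq_rpow_re_of_pos hY0, hwre, norm_pow,
      Real.norm_eq_abs]
    exact mul_le_one₀ (pow_le_one₀ (abs_nonneg _) (by linarith)) (by positivity)
      (Real.rpow_le_one_of_one_le_of_nonpos hY hw0)
  have hyC : ∀ m ∈ Finset.Icc 1 ⌊Y⌋₊, (y m : ℂ) ^ (1 + β * z)
      = ((Y ^ (β + 1) : ℝ) : ℂ) ^ (z + 1 / β) * (m : ℂ) ^ (-(z + 1 / β)) := by
    intro m hm
    have hm0 : (0 : ℝ) < m := by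
      rw [Finset.mem_Icc] at hm
      exact_mod_cast hm.1
    have hmC := ofReal_cpow_eq_exp hm0 (-(z + 1 / β))
    rw [Complex.ofReal_natCast] at hmC
    rw [ofReal_cpow_eq_exp (hY0.trans_le (hYy m hm)), ofReal_cpow_eq_exp (by positivity), hmC,
      ← Complex.exp_add, hy,
      Real.log_rpow (by positivity), Real.log_div (by positivity) hm0.ne']
    congr 1
    push_cast
    field_simp
    ring
  have hNC : ((⌊Y⌋₊ : ℕ) : ℂ) = Y - 1 / 2 - sawtooth Y := by
    rw [← Complex.ofReal_natCast, natCast_floor_eq_sub_sawtooth hY0.le]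
    push_cast
    rfl
  have e₂ : ∀ t : ℝ, ∑ n ∈ Finset.Icc 1 ⌊t⌋₊, (n : ℂ) ^ (β * z) = R₂ t
      + ((t : ℂ) ^ (1 + β * z) / (1 + β * z) + riemannZeta (-(β * z))
        - sawtooth t * (t : ℂ) ^ (β * z)) := fun t => by rw [hR₂]; ring
  have eA : ∑ m ∈ Finset.Icc 1 ⌊Y⌋₊, ∑ d ∈ Finset.Icc 1 ⌊y m⌋₊, (d : ℂ) ^ (β * z)
      = ∑ m ∈ Finset.Icc 1 ⌊Y⌋₊, R₂ (y m)
        + ((Y ^ (β + 1) : ℝ) : ℂ) ^ (z + 1 / β) / (1 + β * z)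
          * ∑ m ∈ Finset.Icc 1 ⌊Y⌋₊, (m : ℂ) ^ (-(z + 1 / β))
        + (Y - 1 / 2 - sawtooth Y) * riemannZeta (-(β * z))
        - ∑ m ∈ Finset.Icc 1 ⌊Y⌋₊, (y m : ℂ) ^ (β * z) * sawtooth (y m) := by
    have h4 : ∀ m ∈ Finset.Icc 1 ⌊Y⌋₊, ∑ d ∈ Finset.Icc 1 ⌊y m⌋₊, (d : ℂ) ^ (β * z)
        = R₂ (y m) + ((Y ^ (β + 1) : ℝ) : ℂ) ^ (z + 1 / β) / (1 + β * z) * (m : ℂ) ^ (-(z + 1 / β))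
          + riemannZeta (-(β * z)) - (y m : ℂ) ^ (β * z) * sawtooth (y m) := by
      intro m hm
      rw [e₂, hyC m hm]
      ring
    rw [Finset.sum_congr rfl h4, Finset.sum_sub_distrib, Finset.sum_add_distrib,
      Finset.sum_add_distrib, ← Finset.mul_sum, Finset.sum_const, Nat.card_Icc, nsmul_eq_mul,
      Nat.add_sub_cancel, hNC]
  have e₁ : ∑ n ∈ Finset.Icc 1 ⌊Y⌋₊, (n : ℂ) ^ (-(β * (1 - z))) = R₁
    + ((Y : ℂ) ^ (1 - β * (1 - z)) / (1 - β * (1 - z)) + riemannZeta (β * (1 - z))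
      - sawtooth Y * (Y : ℂ) ^ (-(β * (1 - z)))) := by rw [hR₁]; ring
  have e₃ : ∑ n ∈ Finset.Icc 1 ⌊Y⌋₊, (n : ℂ) ^ (-(z + 1 / β)) = R₃
    + ((Y : ℂ) ^ (1 - (z + 1 / β)) / (1 - (z + 1 / β)) + riemannZeta (z + 1 / β)
      - sawtooth Y * (Y : ℂ) ^ (-(z + 1 / β))) := by rw [hR₃]; ring
  have hp1 : (Y : ℂ) ^ (1 + β * z) = Y * (Y : ℂ) ^ (β * z) := by
    rw [Complex.cpow_add _ _ hYC, Complex.cpow_one]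
  have hp2 : (Y : ℂ) ^ (β + 1) * (Y : ℂ) ^ (1 - β * (1 - z)) = Y ^ 2 * (Y : ℂ) ^ (β * z) := by
    rw [← Complex.cpow_natCast, ← Complex.cpow_natCast _ 2, ← Complex.cpow_add _ _ hYC,
      ← Complex.cpow_add _ _ hYC]
    congr 1
    push_cast
    ring
  have hp3 : (Y : ℂ) ^ (β + 1) * (Y : ℂ) ^ (-(β * (1 - z))) = Y * (Y : ℂ) ^ (β * z) := by
    rw [← hp1, ← Complex.cpow_natCast, ← Complex.cpow_add _ _ hYC]
    congr 1
    push_cast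
    ring
  have hp4 : ((Y ^ (β + 1) : ℝ) : ℂ) ^ (z + 1 / β) * (Y : ℂ) ^ (-(z + 1 / β))
      = Y * (Y : ℂ) ^ (β * z) := by
    rw [← hp1, ofReal_cpow_eq_exp (by positivity), ofReal_cpow_eq_exp hY0, ofReal_cpow_eq_exp hY0,
      ← Complex.exp_add, hlogx]
    congr 1
    push_cast
    field_simp
    ring
  have hp5 : ((Y ^ (β + 1) : ℝ) : ℂ) ^ (z + 1 / β) * (Y : ℂ) ^ (1 - (z + 1 / β))
      = Y ^ 2 * (Y : ℂ) ^ (β * z) := by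
    rw [sub_eq_add_neg, Complex.cpow_add _ _ hYC, Complex.cpow_one]
    linear_combination (Y : ℂ) * hp4
  have key : ∑ n ∈ Finset.Icc 1 ⌊Y ^ (β + 1)⌋₊, sigmaGen z β n
          - riemannZeta (β * (1 - z)) * (Y ^ (β + 1) : ℝ)
          - riemannZeta (z + 1 / β) * ((Y ^ (β + 1) : ℝ) : ℂ) ^ (z + 1 / β) / (1 + β * z)
          + ∑ d ∈ Finset.Icc 1 ⌊Y⌋₊, (d : ℂ) ^ (β * z) * sawtooth (Y ^ (β + 1) / d ^ β)
          + ∑ m ∈ Finset.Icc 1 ⌊Y⌋₊, (y m : ℂ) ^ (β * z) * sawtooth (y m)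
      = (Y : ℂ) ^ (β + 1) * R₁ - ((Y - sawtooth Y : ℝ) : ℂ) * R₂ Y
        + ∑ m ∈ Finset.Icc 1 ⌊Y⌋₊, R₂ (y m)
        + ((Y ^ (β + 1) : ℝ) : ℂ) ^ (z + 1 / β) / (1 + β * z) * R₃
        - ((sawtooth Y ^ 2 : ℝ) : ℂ) * (Y : ℂ) ^ (β * z) - riemannZeta (-(β * z)) / 2 := by
    rw [sum_sigmaGen_eq z hβ hY, eA, e₁, e₃, e₂ Y, hp1]
    have q1 : (1 : ℂ) - β * (1 - z) ≠ 0 := sub_ne_zero.2 hs1.symm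
    have q2 : (1 : ℂ) - (z + 1 / β) = -(1 - β * (1 - z)) / β := by
      field_simp
      ring
    have q3 : (1 : ℂ) / (1 - β * (1 - z)) + 1 / (1 + β * z) * (1 / (1 - (z + 1 / β)))
        - 1 / (1 + β * z) = 0 := by
      rw [q2]
      field_simp
      ring
    rw [Complex.ofReal_pow] at hp4 hp5 ⊢
    rw [Complex.ofReal_sub, Complex.ofReal_pow]
    generalize (Y : ℂ) ^ (β * z) = P at *
    linear_combination (1 / (1 - β * (1 - z)) : ℂ) * hp2 - (sawtooth Y : ℂ) * hp3
      + (1 / (1 + β * z) * (1 / (1 - (z + 1 / β))) : ℂ) * hp5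
      - (sawtooth Y / (1 + β * z) : ℂ) * hp4 + (Y ^ 2 * P : ℂ) * q3
  rw [key]
  calc _ ≤ K₁ + 2 * K₂ + K₂ + K₃ / ‖1 + β * z‖ + 1 + ‖riemannZeta (-(β * z)) / 2‖ := by
        refine (norm_sub_le _ _).trans (add_le_add_left ?_ _)
        refine (norm_sub_le _ _).trans (add_le_add ?_ B₄)
        refine (norm_add_le _ _).trans (add_le_add ?_ B₃)
        refine (norm_add_le _ _).trans (add_le_add ?_ B₂')
        exact (norm_sub_le _ _).trans (add_le_add B₁ B₂)
    _ ≤ _ := by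
      gcongr
      rw [norm_div, Complex.norm_two]
      exact div_le_self (norm_nonneg _) one_le_two

theorem one_le_log_of_three_le {x : ℝ} (hx : 3 ≤ x) : 1 ≤ Real.log x := by
  rw [Real.le_log_iff_exp_le (by linarith)]
  linarith [Real.exp_one_lt_d9]

theorem norm_sum_mul_sawtooth_div_le (g : ℕ → ℂ) {K x : ℝ} {N : ℕ} (hK : 0 ≤ K) (hx : 3 ≤ x)
    (hN : (N : ℝ) ^ 2 ≤ x) (hg : ∀ n, 1 ≤ n → n ≤ N → ‖g n‖ ≤ 1)
    (hg' : ∀ n, 1 ≤ n → n < N → ‖g (n + 1) - g n‖ ≤ K * (1 / n)) :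
    ‖∑ d ∈ Finset.Icc 1 N, g d * sawtooth (x / d)‖
      ≤ 900 * (1 + 2 * K) * (x ^ ((1 : ℝ) / 3) * Real.log x ^ 2) := by
  have hlog := one_le_log_of_three_le hx
  have hlogN : Real.log N ≤ Real.log x := by
    rcases Nat.eq_zero_or_pos N with rfl | hN0
    · simp only [Nat.cast_zero, Real.log_zero]
      linarith
    · have hN1 : (1 : ℝ) ≤ N := by exact_mod_cast hN0
      exact Real.log_le_log (by linarith) (by nlinarith)
  have h := norm_sum_mul_le_of_slow_variation g (fun n => sawtooth (x / n)) (N := N) hK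
    (fun n hn => abs_sum_sawtooth_div_le hx n
      (le_trans (pow_le_pow_left₀ (by positivity) (by exact_mod_cast hn) 2) hN)) hg hg'
  calc _ ≤ 900 * (x ^ ((1 : ℝ) / 3) * Real.log x) * (1 + K * (1 + Real.log N)) := h
    _ ≤ 900 * (x ^ ((1 : ℝ) / 3) * Real.log x) * ((1 + 2 * K) * Real.log x) := by
      gcongr
      nlinarith
    _ = _ := by ring

theorem norm_ofReal_cpow_le_one {t : ℝ} (ht : 1 ≤ t) {w : ℂ} (hw : w.re ≤ 0) :
    ‖(t : ℂ) ^ w‖ ≤ 1 := by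
  rw [Complex.norm_cpow_eq_rpow_re_of_pos (by linarith)]
  exact Real.rpow_le_one_of_one_le_of_nonpos ht hw

theorem norm_natCast_cpow_le_one {n : ℕ} (hn : 1 ≤ n) {w : ℂ} (hw : w.re ≤ 0) :
    ‖(n : ℂ) ^ w‖ ≤ 1 := by
  rw [← Complex.ofReal_natCast]
  exact norm_ofReal_cpow_le_one (by exact_mod_cast hn) hw

theorem norm_sum_cpow_mul_sawtooth_div_le {z : ℂ} (h2 : z.re ≤ 0) {x : ℝ}
    (hx : 3 ≤ x) {N : ℕ} (hN : (N : ℝ) ^ 2 ≤ x) :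
    ‖∑ d ∈ Finset.Icc 1 N, (d : ℂ) ^ z * sawtooth (x / d)‖
      ≤ 900 * (1 + 2 * ‖z‖) * (x ^ ((1 : ℝ) / 3) * Real.log x ^ 2) := by
  refine norm_sum_mul_sawtooth_div_le (fun n => (n : ℂ) ^ z) (norm_nonneg _) hx hN
    (fun n hn _ => norm_natCast_cpow_le_one hn h2) (fun n hn _ => ?_)
  refine (norm_cpow_succ_sub_le hn (by linarith)).trans ?_
  rw [one_div, ← Real.rpow_neg_one]
  gcongr
  · exact_mod_cast hn
  · linarith

theorem norm_sum_div_cpow_mul_sawtooth_div_le {z : ℂ} (h1 : -1 ≤ z.re) (h2 : z.re ≤ 0) {x : ℝ}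
    (hx : 3 ≤ x) {N : ℕ} (hN : (N : ℝ) ^ 2 ≤ x) :
    ‖∑ d ∈ Finset.Icc 1 N, ((x / d : ℝ) : ℂ) ^ z * sawtooth (x / d)‖
      ≤ 900 * (1 + 2 * ‖z‖) * (x ^ ((1 : ℝ) / 3) * Real.log x ^ 2) := by
  have hx0 : 0 < x := by linarith
  have hle : ∀ n : ℕ, 1 ≤ n → n ≤ N → 1 ≤ x / n := by
    intro n hn hnN
    have h3 : (1 : ℝ) ≤ n := by exact_mod_cast hn
    have h4 : (n : ℝ) ≤ N := by exact_mod_cast hnN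
    rw [one_le_div (by linarith)]
    nlinarith
  have hdiv : ∀ n : ℕ, 1 ≤ n → ((x / n : ℝ) : ℂ) ^ z = (x : ℂ) ^ z * (n : ℂ) ^ (-z) := by
    intro n hn
    have hn0 : (0 : ℝ) < n := by exact_mod_cast hn
    have h3 := ofReal_cpow_eq_exp hn0 (-z)
    rw [Complex.ofReal_natCast] at h3
    rw [ofReal_cpow_eq_exp (by positivity), ofReal_cpow_eq_exp hx0, h3, ← Complex.exp_add,
      Real.log_div hx0.ne' hn0.ne']
    congr 1
    push_cast
    ring
  refine norm_sum_mul_sawtooth_div_le (fun n => ((x / n : ℝ) : ℂ) ^ z) (norm_nonneg _) hx hN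
    (fun n hn hnN => norm_ofReal_cpow_le_one (hle n hn hnN) h2) (fun n hn hnN => ?_)
  have hn0 : (0 : ℝ) < n := by exact_mod_cast hn
  have h4 := norm_cpow_succ_sub_le hn (w := -z) (by rw [Complex.neg_re]; linarith)
  have h5 := norm_ofReal_cpow_le_one (hle n hn hnN.le) h2
  rw [hdiv n hn, norm_mul] at h5
  have h6 : ‖(n : ℂ) ^ (-z)‖ = (n : ℝ) ^ (-z).re := by
    rw [← Complex.ofReal_natCast, Complex.norm_cpow_eq_rpow_re_of_pos hn0]
  rw [h6] at h5
  rw [hdiv n hn, hdiv (n + 1) (by omega), ← mul_sub, norm_mul]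
  rw [norm_neg, Real.rpow_sub_one hn0.ne'] at h4
  calc _ ≤ ‖(x : ℂ) ^ z‖ * (‖z‖ * ((n : ℝ) ^ (-z).re / n)) := by gcongr
    _ = ‖z‖ * ((‖(x : ℂ) ^ z‖ * (n : ℝ) ^ (-z).re) / n) := by ring
    _ ≤ ‖z‖ * (1 / n) := by gcongr

theorem norm_sum_mul_sawtooth_le_card (g : ℕ → ℂ) (a : ℕ → ℝ) {N : ℕ}
    (hg : ∀ n ∈ Finset.Icc 1 N, ‖g n‖ ≤ 1) :
    ‖∑ d ∈ Finset.Icc 1 N, g d * sawtooth (a d)‖ ≤ N := by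
  have h : ∀ d ∈ Finset.Icc 1 N, ‖g d * sawtooth (a d)‖ ≤ 1 := by
    intro d hd
    rw [norm_mul, Complex.norm_real, Real.norm_eq_abs]
    exact mul_le_one₀ (hg d hd) (abs_nonneg _) ((abs_sawtooth_le _).trans (by norm_num))
  simpa using norm_sum_le_of_le _ h

theorem one_le_rpow_mul_log_sq {x : ℝ} (hx : 3 ≤ x) :
    1 ≤ x ^ ((1 : ℝ) / 3) * Real.log x ^ 2 :=
  one_le_mul_of_one_le_of_one_le (Real.one_le_rpow (by linarith) (by norm_num))
    (one_le_pow₀ (one_le_log_of_three_le hx))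

/-- The unprimed form of the summation formula. -/
theorem exists_norm_sum_sigmaGen_sub_main_le (β : ℕ) (hβ : β = 1 ∨ β = 2) (z : ℂ)
    (h1 : -2 / (3 * (β : ℝ) ^ 2) < z.re) (h2 : z.re ≤ 0) (h3 : β = 1 → z ≠ 0) :
    ∃ C ≥ 0, ∀ x : ℝ, 3 ≤ x →
      ‖∑ n ∈ Finset.Icc 1 ⌊x⌋₊, sigmaGen z β n - riemannZeta ((β : ℂ) * (1 - z)) * (x : ℂ)
          - riemannZeta (z + 1 / (β : ℂ)) * (x : ℂ) ^ (z + 1 / (β : ℂ)) / (1 + (β : ℂ) * z)‖ ≤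
        C * (x ^ ((1 : ℝ) / 3) * (Real.log x) ^ 2) := by
  have hre : -1 < β * z.re := by
    rcases hβ with rfl | rfl <;> norm_num at h1 ⊢ <;> linarith
  have hne : (1 + β * z : ℂ) ≠ β := by
    rcases hβ with rfl | rfl
    · intro h
      exact h3 rfl (by push_cast at h; linear_combination h)
    · intro h
      have h4 := congrArg Complex.re h
      norm_num at h4
      linarith
  obtain ⟨K, hK, H⟩ := exists_norm_sum_sigmaGen_sub_le (by omega) hre h2 hne
  have hsaw : ∃ K' ≥ 0, ∀ Y : ℝ, 1 ≤ Y → 3 ≤ Y ^ (β + 1) →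
      ‖∑ d ∈ Finset.Icc 1 ⌊Y⌋₊, (d : ℂ) ^ (β * z) * sawtooth (Y ^ (β + 1) / d ^ β)‖
        ≤ K' * ((Y ^ (β + 1)) ^ ((1 : ℝ) / 3) * Real.log (Y ^ (β + 1)) ^ 2) ∧
      ‖∑ m ∈ Finset.Icc 1 ⌊Y⌋₊, (((Y ^ (β + 1) / m) ^ (1 / (β : ℝ)) : ℝ) : ℂ) ^ (β * z)
          * sawtooth ((Y ^ (β + 1) / m) ^ (1 / (β : ℝ)))‖
        ≤ K' * ((Y ^ (β + 1)) ^ ((1 : ℝ) / 3) * Real.log (Y ^ (β + 1)) ^ 2) := by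
    rcases hβ with rfl | rfl
    · refine ⟨900 * (1 + 2 * ‖z‖), by positivity, fun Y hY hY3 => ?_⟩
      have hN : ((⌊Y⌋₊ : ℕ) : ℝ) ^ 2 ≤ Y ^ (1 + 1) :=
        pow_le_pow_left₀ (by positivity) (Nat.floor_le (by linarith)) 2
      norm_num at hre
      constructor
      · simpa using norm_sum_cpow_mul_sawtooth_div_le h2 hY3 hN
      · simpa using norm_sum_div_cpow_mul_sawtooth_div_le hre.le h2 hY3 hN
    · refine ⟨1, zero_le_one, fun Y hY hY3 => ?_⟩
      have hw : (((2 : ℕ) : ℂ) * z).re ≤ 0 := by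
        norm_num
        linarith
      have hNY : ((⌊Y⌋₊ : ℕ) : ℝ)
          ≤ 1 * ((Y ^ (2 + 1)) ^ ((1 : ℝ) / 3) * Real.log (Y ^ (2 + 1)) ^ 2) := by
        have h4 : (Y ^ (2 + 1)) ^ ((1 : ℝ) / 3) = Y := by
          rw [← Real.rpow_natCast, ← Real.rpow_mul (by linarith)]
          norm_num
        rw [h4, one_mul]
        refine (Nat.floor_le (by linarith)).trans (le_mul_of_one_le_right (by linarith) ?_)
        exact one_le_pow₀ (one_le_log_of_three_le hY3)
      refine ⟨(norm_sum_mul_sawtooth_le_card _ _ fun n hn => ?_).trans hNY,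
        (norm_sum_mul_sawtooth_le_card _ _ fun n hn => ?_).trans hNY⟩
      · exact norm_natCast_cpow_le_one (Finset.mem_Icc.1 hn).1 hw
      · refine norm_ofReal_cpow_le_one (Real.one_le_rpow ?_ (by norm_num)) hw
        rw [Finset.mem_Icc] at hn
        have hn1 : (1 : ℝ) ≤ n := by exact_mod_cast hn.1
        have hn2 : (n : ℝ) ≤ Y := le_trans (by exact_mod_cast hn.2) (Nat.floor_le (by linarith))
        rw [one_le_div (by linarith)]
        exact hn2.trans (le_self_pow₀ hY (by omega))
  obtain ⟨K', hK', H'⟩ := hsaw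
  refine ⟨K + K' + K', by positivity, fun x hx => ?_⟩
  obtain ⟨Y, hY, rfl⟩ : ∃ Y : ℝ, 1 ≤ Y ∧ Y ^ (β + 1) = x := by
    refine ⟨x ^ (((β + 1 : ℕ) : ℝ)⁻¹), Real.one_le_rpow (by linarith) (by positivity), ?_⟩
    exact Real.rpow_inv_natCast_pow (by linarith) (by omega)
  have hK1 := H Y hY
  obtain ⟨hE1, hE2⟩ := H' Y hY hx
  have hX := one_le_rpow_mul_log_sq hx
  generalize (Y ^ (β + 1)) ^ ((1 : ℝ) / 3) * Real.log (Y ^ (β + 1)) ^ 2 = X at *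
  generalize ∑ n ∈ Finset.Icc 1 ⌊Y ^ (β + 1)⌋₊, sigmaGen z β n
      - riemannZeta ((β : ℂ) * (1 - z)) * ((Y ^ (β + 1) : ℝ) : ℂ)
      - riemannZeta (z + 1 / (β : ℂ)) * ((Y ^ (β + 1) : ℝ) : ℂ) ^ (z + 1 / (β : ℂ))
        / (1 + (β : ℂ) * z) = D at *
  generalize ∑ d ∈ Finset.Icc 1 ⌊Y⌋₊, (d : ℂ) ^ (β * z) * sawtooth (Y ^ (β + 1) / d ^ β) = E₁ at *
  generalize ∑ m ∈ Finset.Icc 1 ⌊Y⌋₊, (((Y ^ (β + 1) / m) ^ (1 / (β : ℝ)) : ℝ) : ℂ) ^ (β * z)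
    * sawtooth ((Y ^ (β + 1) / m) ^ (1 / (β : ℝ))) = E₂ at *
  calc ‖D‖ = ‖D + E₁ + E₂ - E₁ - E₂‖ := by congr 1; ring
    _ ≤ ‖D + E₁ + E₂‖ + ‖E₁‖ + ‖E₂‖ :=
      (norm_sub_le _ _).trans (add_le_add_left (norm_sub_le _ _) _)
    _ ≤ K + K' * X + K' * X := by gcongr
    _ ≤ K * X + K' * X + K' * X := by gcongr; exact le_mul_of_one_le_right hK hX
    _ = _ := by ring

/-- Isolated terms of a sum whose summatory function is close to a continuous function are small. -/
theorem norm_term_le_of_norm_sum_sub_le {f : ℕ → ℂ} {M : ℝ → ℂ} {E : ℝ → ℝ} {n : ℕ} {a : ℝ}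
    (han : a < n) (hM : ContinuousAt M n) (hE : ContinuousAt E n) (hn : 1 ≤ n)
    (h : ∀ x, a ≤ x → ‖∑ k ∈ Finset.Icc 1 ⌊x⌋₊, f k - M x‖ ≤ E x) :
    ‖f n‖ ≤ 2 * E n := by
  have hlim : Filter.Tendsto (fun t => E n + ‖M n - M t‖ + E t) (nhdsWithin (n : ℝ) (Set.Iio n))
      (nhds (E n + ‖M n - M n‖ + E n)) :=
    Filter.Tendsto.mono_left (((tendsto_const_nhds.sub hM).norm.const_add _).add hE)
      nhdsWithin_le_nhds
  rw [sub_self, norm_zero, add_zero, ← two_mul] at hlim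
  refine ge_of_tendsto hlim ?_
  have hn' : ((n : ℝ) - 1) < n := by linarith
  filter_upwards [Ioo_mem_nhdsLT han, Ioo_mem_nhdsLT hn'] with t ht ht'
  have hn1 : (1 : ℝ) ≤ n := by exact_mod_cast hn
  have hfl : ⌊t⌋₊ = n - 1 := by
    rw [Nat.floor_eq_iff (by linarith [ht'.1]), Nat.cast_sub hn, Nat.cast_one]
    exact ⟨ht'.1.le, by linarith [ht'.2]⟩
  have e : f n = (∑ k ∈ Finset.Icc 1 ⌊(n : ℝ)⌋₊, f k - M n) + (M n - M t)
      - (∑ k ∈ Finset.Icc 1 ⌊t⌋₊, f k - M t) := by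
    obtain ⟨m, rfl⟩ : ∃ m, n = m + 1 := ⟨n - 1, by omega⟩
    rw [hfl, Nat.floor_natCast, Finset.sum_Icc_succ_top (by omega), Nat.add_sub_cancel]
    ring
  rw [e]
  exact (norm_sub_le _ _).trans (add_le_add ((norm_add_le _ _).trans
    (add_le_add_left (h n han.le) _)) (h t ht.1.le))

theorem sigma_sum_small_beta (β : ℕ) (hβ : β = 1 ∨ β = 2) (z : ℂ)
    (h1 : -2 / (3 * (β : ℝ) ^ 2) < z.re) (h2 : z.re ≤ 0) (h3 : β = 1 → z ≠ 0) :
    ∃ C > 0, ∀ x : ℝ, 3 ≤ x →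
      ‖primedSum (sigmaGen z β) x - riemannZeta ((β : ℂ) * (1 - z)) * (x : ℂ)
          - riemannZeta (z + 1 / (β : ℂ)) * (x : ℂ) ^ (z + 1 / (β : ℂ)) / (1 + (β : ℂ) * z)‖ ≤
        C * (x ^ ((1 : ℝ) / 3) * (Real.log x) ^ 2) := by
  obtain ⟨C, hC, H⟩ := exists_norm_sum_sigmaGen_sub_main_le β hβ z h1 h2 h3
  refine ⟨2 * C + ‖sigmaGen z β 3‖ + 1, by positivity, fun x hx => ?_⟩
  have hX := one_le_rpow_mul_log_sq hx
  have hcorr : ‖if (⌊x⌋₊ : ℝ) = x then sigmaGen z β ⌊x⌋₊ / 2 else 0‖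
      ≤ (C + ‖sigmaGen z β 3‖) * (x ^ ((1 : ℝ) / 3) * (Real.log x) ^ 2) := by
    split_ifs with hxn
    · rw [norm_div, Complex.norm_two]
      generalize ⌊x⌋₊ = n at hxn
      subst hxn
      have hn : 3 ≤ n := by exact_mod_cast hx
      rcases hn.eq_or_lt with rfl | hn
      · have h0 := norm_nonneg (sigmaGen z β 3)
        nlinarith [mul_nonneg hC (zero_le_one.trans hX)]
      · have hn0 : (0 : ℝ) < n := by linarith
        have h4 := norm_term_le_of_norm_sum_sub_le (f := sigmaGen z β) (n := n) (a := 3)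
          (M := fun x => riemannZeta ((β : ℂ) * (1 - z)) * (x : ℂ)
            + riemannZeta (z + 1 / (β : ℂ)) * (x : ℂ) ^ (z + 1 / (β : ℂ)) / (1 + (β : ℂ) * z))
          (E := fun x => C * (x ^ ((1 : ℝ) / 3) * (Real.log x) ^ 2))
          (by exact_mod_cast hn) ?_ ?_ (by omega) (fun x hx => by
            rw [← sub_sub]
            exact H x hx)
        · nlinarith [norm_nonneg (sigmaGen z β 3)]
        · have := (hasDerivAt_ofReal_cpow hn0 (z + 1 / (β : ℂ))).continuousAt
          exact (continuousAt_const.mul Complex.continuous_ofReal.continuousAt).add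
            ((continuousAt_const.mul this).div_const _)
        · exact continuousAt_const.mul ((Real.continuousAt_rpow_const _ _ (Or.inl hn0.ne')).mul
            ((Real.continuousAt_log hn0.ne').pow 2))
    · rw [norm_zero]
      positivity
  rw [primedSum, sub_right_comm _ _ (riemannZeta ((β : ℂ) * (1 - z)) * (x : ℂ)),
    sub_right_comm _ (ite _ _ _)]
  refine (norm_sub_le _ _).trans ((add_le_add (H x hx) hcorr).trans ?_)
  linarith
end

section
/- Let β ≥ 3 be an integer and let z₁, z₂ ∈ ℂ satisfy z₁ ≠ 0, z₂ ≠ 0, z₁ ≠ z₂, Re(z₁) ≤ 0, Re(z₂) ≤ 0, Re(z₁ + z₂) > −1, and |Re(z₁ − z₂)| < 1/β. There exists a constant C > 0 such that for all reals x ≥ 3 one has | Σ'_{n ≤ x} σ_{z₁,β}(n)σ_{z₂,β}(n) − [ζ(β(1−z₁))ζ(β(1−z₂))ζ(β(1−z₁−z₂))/ζ(β(2−z₁−z₂))]·x | ≤ C · max( x^{1/(2β) + (Re(z₁)+Re(z₂))/2 + β|Re(z₁)−Re(z₂)|/3}, x^{1/3 + 1/(6β) + (Re(z₁)+Re(z₂))/6}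 ) (log x)^5 (log log x). -/
open Complex Finset
open scoped Classical

/-- Splitting a pair of positive integers into its gcd and a coprime pair. -/
noncomputable def gcdCoprimeEquiv :
    ℕ+ × {p : ℕ+ × ℕ+ // Nat.Coprime p.1 p.2} ≃ ℕ+ × ℕ+ :=
  Equiv.ofBijective (fun q => (q.1 * q.2.1.1, q.1 * q.2.1.2)) <| by
    constructor
    · rintro ⟨g, ⟨a, b⟩, hab⟩ ⟨g', ⟨a', b'⟩, hab'⟩ h
      simp only [Prod.mk.injEq] at h
      obtain ⟨ha, hb⟩ := h
      have hg : g = g' := by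
        have ha' : (g : ℕ) * a = g' * a' := by exact_mod_cast congrArg PNat.val ha
        have hb' : (g : ℕ) * b = g' * b' := by exact_mod_cast congrArg PNat.val hb
        have hgcd : Nat.gcd (g * a) (g * b) = Nat.gcd (g' * a') (g' * b') := by rw [ha', hb']
        rw [Nat.gcd_mul_left, Nat.gcd_mul_left, Nat.Coprime.gcd_eq_one hab,
          Nat.Coprime.gcd_eq_one hab', mul_one, mul_one] at hgcd
        exact PNat.eq hgcd
      subst hg
      simp only [mul_right_inj] at ha hb
      simp [ha, hb]
    · rintro ⟨m, n⟩
      obtain ⟨a, b, hab, ha, hb⟩ := Nat.exists_coprime (m : ℕ) n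
      have hapos : 0 < a := Nat.pos_of_ne_zero fun h => m.ne_zero (by rw [ha, h, zero_mul])
      have hbpos : 0 < b := Nat.pos_of_ne_zero fun h => n.ne_zero (by rw [hb, h, zero_mul])
      refine ⟨(⟨Nat.gcd m n, Nat.gcd_pos_of_pos_left _ m.pos⟩, ⟨(⟨a, hapos⟩, ⟨b, hbpos⟩), hab⟩),
        ?_⟩
      refine Prod.ext (PNat.eq ?_) (PNat.eq ?_)
      · exact (mul_comm _ _).trans ha.symm
      · exact (mul_comm _ _).trans hb.symm

@[simp]
theorem gcdCoprimeEquiv_apply (q : ℕ+ × {p : ℕ+ × ℕ+ // Nat.Coprime p.1 p.2}) :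
    gcdCoprimeEquiv q = (q.1 * q.2.1.1, q.1 * q.2.1.2) := rfl

theorem summable_norm_pnat_cpow {p : ℂ} (hp : 1 < p.re) :
    Summable fun n : ℕ+ => ‖(n : ℂ) ^ (-p)‖ := by
  have h := ((Complex.summable_one_div_nat_cpow (p := p)).mpr hp).norm
  refine (h.comp_injective PNat.coe_injective).congr fun n => ?_
  simp [Complex.cpow_neg]

theorem tsum_pnat_cpow_eq_riemannZeta {p : ℂ} (hp : 1 < p.re) :
    ∑' n : ℕ+, (n : ℂ) ^ (-p) = riemannZeta p := by
  rw [zeta_eq_tsum_one_div_nat_add_one_cpow hp,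
    tsum_pnat_eq_tsum_succ (f := fun n : ℕ => (n : ℂ) ^ (-p))]
  simp [Complex.cpow_neg]

theorem summable_norm_pnat_prod_cpow {p q : ℂ} (hp : 1 < p.re) (hq : 1 < q.re) :
    Summable fun d : ℕ+ × ℕ+ => ‖(d.1 : ℂ) ^ (-p) * (d.2 : ℂ) ^ (-q)‖ :=
  Summable.mul_norm (f := fun n : ℕ+ => (n : ℂ) ^ (-p)) (g := fun n : ℕ+ => (n : ℂ) ^ (-q))
    (summable_norm_pnat_cpow hp) (summable_norm_pnat_cpow hq)

/-- The Dirichlet series in two variables over coprime pairs. -/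
noncomputable def coprimeZeta (p q : ℂ) : ℂ :=
  ∑' c : {c : ℕ+ × ℕ+ // Nat.Coprime c.1 c.2}, (c.1.1 : ℂ) ^ (-p) * (c.1.2 : ℂ) ^ (-q)

theorem summable_norm_coprime_cpow {p q : ℂ} (hp : 1 < p.re) (hq : 1 < q.re) :
    Summable fun c : {c : ℕ+ × ℕ+ // Nat.Coprime c.1 c.2} =>
      ‖(c.1.1 : ℂ) ^ (-p) * (c.1.2 : ℂ) ^ (-q)‖ :=
  (summable_norm_pnat_prod_cpow hp hq).comp_injective Subtype.val_injective

theorem riemannZeta_mul_coprimeZeta {p q : ℂ} (hp : 1 < p.re) (hq : 1 < q.re) :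
    riemannZeta (p + q) * coprimeZeta p q = riemannZeta p * riemannZeta q := by
  have hpq : 1 < (p + q).re := by rw [add_re]; linarith
  rw [← tsum_pnat_cpow_eq_riemannZeta hp, ← tsum_pnat_cpow_eq_riemannZeta hq,
    ← tsum_pnat_cpow_eq_riemannZeta hpq, coprimeZeta,
    tsum_mul_tsum_of_summable_norm (summable_norm_pnat_cpow hpq)
      (summable_norm_coprime_cpow hp hq),
    tsum_mul_tsum_of_summable_norm (summable_norm_pnat_cpow hp) (summable_norm_pnat_cpow hq),
    ← gcdCoprimeEquiv.tsum_eq]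
  refine tsum_congr fun c => ?_
  have hg : (c.1 : ℂ) ≠ 0 := by exact_mod_cast c.1.ne_zero
  simp only [gcdCoprimeEquiv_apply, PNat.mul_coe, Nat.cast_mul, natCast_mul_natCast_cpow,
    neg_add, Complex.cpow_add _ _ hg]
  ring

/-- The general term of the two-variable series weighted by a power of the lcm. -/
noncomputable def lcmTerm (u v w : ℂ) (d : ℕ+ × ℕ+) : ℂ :=
  (d.1 : ℂ) ^ u * (d.2 : ℂ) ^ v * (Nat.lcm d.1 d.2 : ℂ) ^ (-w)

theorem lcmTerm_gcdCoprimeEquiv (u v w : ℂ)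
    (c : ℕ+ × {p : ℕ+ × ℕ+ // Nat.Coprime p.1 p.2}) :
    lcmTerm u v w (gcdCoprimeEquiv c) = (c.1 : ℂ) ^ (-(w - u - v)) *
      ((c.2.1.1 : ℂ) ^ (-(w - u)) * (c.2.1.2 : ℂ) ^ (-(w - v))) := by
  have hg : (c.1 : ℂ) ≠ 0 := by exact_mod_cast c.1.ne_zero
  have ha : (c.2.1.1 : ℂ) ≠ 0 := by exact_mod_cast c.2.1.1.ne_zero
  have hb : (c.2.1.2 : ℂ) ≠ 0 := by exact_mod_cast c.2.1.2.ne_zero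
  have e₁ : -(w - u - v) = u + v + -w := by ring
  have e₂ : -(w - u) = u + -w := by ring
  have e₃ : -(w - v) = v + -w := by ring
  simp only [lcmTerm, gcdCoprimeEquiv_apply, PNat.mul_coe, Nat.lcm_mul_left,
    c.2.2.lcm_eq_mul, Nat.cast_mul, natCast_mul_natCast_cpow, e₁, e₂, e₃,
    Complex.cpow_add _ _ hg, Complex.cpow_add _ _ ha, Complex.cpow_add _ _ hb]
  have := natCast_mul_natCast_cpow (c.2.1.1 : ℕ) (c.2.1.2 : ℕ) (-w)
  have h2 := natCast_mul_natCast_cpow (c.1 : ℕ) ((c.2.1.1 : ℕ) * (c.2.1.2 : ℕ)) (-w)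
  push_cast at h2
  rw [h2, this]
  ring

theorem summable_norm_lcmTerm {u v w : ℂ} (huv : 1 < (w - u - v).re) (hu : 1 < (w - u).re)
    (hv : 1 < (w - v).re) : Summable fun d => ‖lcmTerm u v w d‖ := by
  rw [← gcdCoprimeEquiv.summable_iff]
  refine ((summable_norm_pnat_cpow huv).mul_norm (summable_norm_coprime_cpow hu hv)).congr
    fun c => ?_
  rw [Function.comp_apply, lcmTerm_gcdCoprimeEquiv]

theorem tsum_lcmTerm {u v w : ℂ} (huv : 1 < (w - u - v).re) (hu : 1 < (w - u).re)
    (hv : 1 < (w - v).re) :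
    ∑' d, lcmTerm u v w d = riemannZeta (w - u) * riemannZeta (w - v) *
      riemannZeta (w - u - v) / riemannZeta (w - u + (w - v)) := by
  have hne : riemannZeta (w - u + (w - v)) ≠ 0 :=
    riemannZeta_ne_zero_of_one_lt_re (by rw [add_re]; linarith)
  rw [← gcdCoprimeEquiv.tsum_eq, eq_div_iff hne, ← riemannZeta_mul_coprimeZeta hu hv,
    ← tsum_pnat_cpow_eq_riemannZeta huv]
  simp only [lcmTerm_gcdCoprimeEquiv]
  rw [← tsum_mul_tsum_of_summable_norm (summable_norm_pnat_cpow huv)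
    (summable_norm_coprime_cpow hu hv)]
  simp only [coprimeZeta]
  ring

theorem hasSum_sigmaGen (z : ℂ) {β n : ℕ} (hβ : β ≠ 0) (hn : 0 < n) :
    HasSum (fun d : ℕ+ => if (d : ℕ) ^ β ∣ n then (d : ℂ) ^ ((β : ℂ) * z) else 0)
      (sigmaGen z β n) := by
  lift n to ℕ+ using hn
  have hsum : sigmaGen z β n = ∑ d ∈ Finset.Icc 1 n,
      if (d : ℕ) ^ β ∣ n then (d : ℂ) ^ ((β : ℂ) * z) else 0 := by
    rw [sigmaGen, Finset.sum_filter, ← PNat.one_coe, ← PNat.map_subtype_embedding_Icc]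
    exact Finset.sum_map _ _ _
  rw [hsum]
  refine hasSum_sum_of_ne_finset_zero fun d hd => if_neg fun hdvd => hd ?_
  exact Finset.mem_Icc.mpr
    ⟨one_le, (Nat.le_self_pow hβ d).trans (Nat.le_of_dvd n.pos hdvd)⟩

theorem hasSum_sigmaGen_mul (z₁ z₂ : ℂ) {β n : ℕ} (hβ : β ≠ 0) (hn : 0 < n) :
    HasSum (fun d : ℕ+ × ℕ+ => if Nat.lcm d.1 d.2 ^ β ∣ n then
        (d.1 : ℂ) ^ ((β : ℂ) * z₁) * (d.2 : ℂ) ^ ((β : ℂ) * z₂) else 0)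
      (sigmaGen z₁ β n * sigmaGen z₂ β n) := by
  have h₁ := hasSum_sigmaGen z₁ hβ hn
  have h₂ := hasSum_sigmaGen z₂ hβ hn
  have h := h₁.mul h₂ <| summable_mul_of_summable_norm
    (f := fun d : ℕ+ => if (d : ℕ) ^ β ∣ n then (d : ℂ) ^ ((β : ℂ) * z₁) else 0)
    (g := fun d : ℕ+ => if (d : ℕ) ^ β ∣ n then (d : ℂ) ^ ((β : ℂ) * z₂) else 0)
    h₁.summable.norm h₂.summable.norm
  refine (congrArg (HasSum · _) (funext fun d => ?_)).mpr h
  simp only [← Nat.pow_lcm_pow, Nat.lcm_dvd_iff]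
  split_ifs <;> simp_all

theorem hasSum_sum_sigmaGen_mul (z₁ z₂ : ℂ) {β : ℕ} (hβ : β ≠ 0) (N : ℕ) :
    HasSum (fun d : ℕ+ × ℕ+ => (d.1 : ℂ) ^ ((β : ℂ) * z₁) * (d.2 : ℂ) ^ ((β : ℂ) * z₂) *
        ((N / Nat.lcm d.1 d.2 ^ β : ℕ) : ℂ))
      (∑ n ∈ Finset.Icc 1 N, sigmaGen z₁ β n * sigmaGen z₂ β n) := by
  have h := hasSum_sum fun n (hn : n ∈ Finset.Icc 1 N) =>
    hasSum_sigmaGen_mul z₁ z₂ hβ (Finset.mem_Icc.mp hn).1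
  convert h using 2 with d
  rw [← Finset.sum_filter, Finset.sum_const, nsmul_eq_mul, mul_comm,
    ← Nat.Ioc_filter_dvd_card_eq_div, ← Finset.Icc_add_one_left_eq_Ioc, zero_add]

theorem abs_floor_sub_le_rpow {t θ : ℝ} (ht : 0 < t) (h0 : 0 ≤ θ) (h1 : θ ≤ 1) :
    |(⌊t⌋₊ : ℝ) - t| ≤ t ^ θ := by
  have hle := Nat.floor_le ht.le
  rw [abs_sub_comm, abs_of_nonneg (sub_nonneg.mpr hle)]
  rcases le_total t 1 with h | h
  · have := Real.rpow_le_rpow_of_exponent_ge ht h h1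
    rw [Real.rpow_one] at this
    linarith [Nat.cast_nonneg (α := ℝ) ⌊t⌋₊]
  · linarith [Real.one_le_rpow h h0, Nat.lt_floor_add_one t]

theorem norm_lcmTerm_mul_rpow (u v : ℂ) (β : ℕ) (θ : ℝ) {x : ℝ} (hx : 0 < x) (d : ℕ+ × ℕ+) :
    ‖lcmTerm u v ((β * θ : ℝ) : ℂ) d‖ * x ^ θ =
      ‖(d.1 : ℂ) ^ u * (d.2 : ℂ) ^ v‖ * (x / ((Nat.lcm d.1 d.2 ^ β : ℕ) : ℝ)) ^ θ := by
  have hl : 0 < Nat.lcm d.1 d.2 := Nat.lcm_pos d.1.pos d.2.pos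
  have hl' : (0 : ℝ) ≤ (Nat.lcm d.1 d.2 : ℝ) := Nat.cast_nonneg _
  rw [lcmTerm, norm_mul, norm_natCast_cpow_of_pos hl, Real.div_rpow hx.le (by positivity),
    neg_re, ofReal_re, Real.rpow_neg hl', Real.rpow_mul hl', Real.rpow_natCast, Nat.cast_pow]
  ring

theorem lcmTerm_natCast (u v : ℂ) (β : ℕ) (d : ℕ+ × ℕ+) :
    lcmTerm u v β d = (d.1 : ℂ) ^ u * (d.2 : ℂ) ^ v / ((Nat.lcm d.1 d.2 ^ β : ℕ) : ℂ) := by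
  rw [lcmTerm, Complex.cpow_neg, Complex.cpow_natCast, Nat.cast_pow, div_eq_mul_inv]

/-- If the lcm series converges absolutely at `βθ`, then the error term is `O(x^θ)`. -/
theorem norm_primedSum_sigmaGen_mul_sub_le {β : ℕ} (hβ : β ≠ 0) (z₁ z₂ : ℂ) {θ : ℝ}
    (h0 : 0 ≤ θ) (h1 : θ ≤ 1)
    (hθ : Summable fun d => ‖lcmTerm (β * z₁) (β * z₂) ((β * θ : ℝ) : ℂ) d‖)
    (hmain : Summable (lcmTerm (β * z₁) (β * z₂) β)) {x : ℝ} (hx : 1 ≤ x) :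
    ‖primedSum (fun n => sigmaGen z₁ β n * sigmaGen z₂ β n) x -
        (∑' d, lcmTerm (β * z₁) (β * z₂) β d) * (x : ℂ)‖ ≤
      2 * ((∑' d, ‖lcmTerm (β * z₁) (β * z₂) ((β * θ : ℝ) : ℂ) d‖) * x ^ θ) := by
  have hx0 : 0 < x := by linarith
  have hN : 0 < ⌊x⌋₊ := Nat.floor_pos.mpr hx
  have hmaj := (hθ.hasSum).mul_right (x ^ θ)
  have hdiff := (hasSum_sum_sigmaGen_mul z₁ z₂ hβ ⌊x⌋₊).sub (hmain.hasSum.mul_right (x : ℂ))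
  have hA := hdiff.norm_le_of_bounded hmaj fun d => by
    have hl : 0 < Nat.lcm d.1 d.2 ^ β := pow_pos (Nat.lcm_pos d.1.pos d.2.pos) _
    have hl' : (0 : ℝ) < ((Nat.lcm d.1 d.2 ^ β : ℕ) : ℝ) := Nat.cast_pos.mpr hl
    rw [norm_lcmTerm_mul_rpow _ _ _ _ hx0, lcmTerm_natCast, div_mul_eq_mul_div, mul_div_assoc,
      ← mul_sub, norm_mul, ← Nat.floor_div_natCast]
    gcongr
    have := abs_floor_sub_le_rpow (div_pos hx0 hl') h0 h1
    rw [← Real.norm_eq_abs, ← Complex.norm_real] at this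
    push_cast at this ⊢
    exact this
  have hB := (hasSum_sigmaGen_mul z₁ z₂ hβ hN).norm_le_of_bounded hmaj fun d => by
    have hl : 0 < Nat.lcm d.1 d.2 ^ β := pow_pos (Nat.lcm_pos d.1.pos d.2.pos) _
    have hl' : (0 : ℝ) < ((Nat.lcm d.1 d.2 ^ β : ℕ) : ℝ) := Nat.cast_pos.mpr hl
    rw [norm_lcmTerm_mul_rpow _ _ _ _ hx0]
    split_ifs with hdvd
    · refine le_mul_of_one_le_right (norm_nonneg _) (Real.one_le_rpow ?_ h0)
      rw [one_le_div hl']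
      exact (Nat.cast_le.mpr (Nat.le_of_dvd hN hdvd)).trans (Nat.floor_le hx0.le)
    · rw [norm_zero]
      positivity
  have hC : ‖(if (⌊x⌋₊ : ℝ) = x then sigmaGen z₁ β ⌊x⌋₊ * sigmaGen z₂ β ⌊x⌋₊ / 2 else 0 : ℂ)‖ ≤
      (∑' d, ‖lcmTerm (β * z₁) (β * z₂) ((β * θ : ℝ) : ℂ) d‖) * x ^ θ := by
    split_ifs
    · rw [norm_div, Complex.norm_two]
      linarith [norm_nonneg (sigmaGen z₁ β ⌊x⌋₊ * sigmaGen z₂ β ⌊x⌋₊)]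
    · rw [norm_zero]
      exact (norm_nonneg _).trans hB
  rw [primedSum, sub_right_comm, two_mul]
  exact (norm_sub_le _ _).trans (add_le_add hA hC)

theorem sigma_product_sum_large_beta (β : ℕ) (hβ : 3 ≤ β) (z₁ z₂ : ℂ)
    (h₁ : z₁ ≠ 0) (h₂ : z₂ ≠ 0) (h₃ : z₁ ≠ z₂)
    (h4 : z₁.re ≤ 0) (h5 : z₂.re ≤ 0) (h6 : -1 < (z₁ + z₂).re)
    (h7 : |(z₁ - z₂).re| < 1 / (β : ℝ)) :
    ∃ C > 0, ∀ x : ℝ, 3 ≤ x →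
      ‖primedSum (fun n => sigmaGen z₁ β n * sigmaGen z₂ β n) x -
          riemannZeta ((β : ℂ) * (1 - z₁)) * riemannZeta ((β : ℂ) * (1 - z₂)) *
            riemannZeta ((β : ℂ) * (1 - z₁ - z₂)) /
            riemannZeta ((β : ℂ) * (2 - z₁ - z₂)) * (x : ℂ)‖ ≤
        C * (max
            (x ^ (1 / (2 * (β : ℝ)) + (z₁.re + z₂.re) / 2 + (β : ℝ) * |z₁.re - z₂.re| / 3))
            (x ^ ((1 : ℝ) / 3 + 1 / (6 * (β : ℝ)) + (z₁.re + z₂.re) / 6)) *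
          (Real.log x) ^ 5 * Real.log (Real.log x)) := by
  have hβ0 : β ≠ 0 := by omega
  have hβR : (3 : ℝ) ≤ β := by exact_mod_cast hβ
  have hβpos : (0 : ℝ) < β := by linarith
  rw [add_re] at h6
  rw [sub_re, abs_lt] at h7
  obtain ⟨h7l, h7r⟩ := h7
  have ht : 1 / (β : ℝ) ≤ 1 / 3 := one_div_le_one_div_of_le (by norm_num) hβR
  have ht0 : 0 < 1 / (β : ℝ) := by positivity
  have ht6 : 1 / (6 * (β : ℝ)) = 1 / (β : ℝ) / 6 := by field_simp
  set θ : ℝ := (1 : ℝ) / 3 + 1 / (6 * (β : ℝ)) + (z₁.re + z₂.re) / 6 with hθdef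
  have hmul : ∀ {s : ℝ}, 1 / (β : ℝ) < s → 1 < β * s := fun {s} hs => by
    rwa [div_lt_iff₀' hβpos] at hs
  have hθ₁ : 1 < β * (θ - z₁.re) := hmul (by linarith)
  have hθ₂ : 1 < β * (θ - z₂.re) := hmul (by linarith)
  have hθ₁₂ : 1 < β * (θ - z₁.re - z₂.re) := hmul (by linarith)
  have hm₁ : 1 < β * (1 - z₁.re) := hmul (by linarith)
  have hm₂ : 1 < β * (1 - z₂.re) := hmul (by linarith)
  have hm₁₂ : 1 < β * (1 - z₁.re - z₂.re) := hmul (by linarith)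
  have hsθ : Summable fun d => ‖lcmTerm (β * z₁) (β * z₂) ((β * θ : ℝ) : ℂ) d‖ := by
    apply summable_norm_lcmTerm <;> simp <;> linarith
  have cm₁₂ : 1 < ((β : ℂ) - β * z₁ - β * z₂).re := by simp; linarith
  have cm₁ : 1 < ((β : ℂ) - β * z₁).re := by simp; linarith
  have cm₂ : 1 < ((β : ℂ) - β * z₂).re := by simp; linarith
  have hconst : riemannZeta ((β : ℂ) * (1 - z₁)) * riemannZeta ((β : ℂ) * (1 - z₂)) *
      riemannZeta ((β : ℂ) * (1 - z₁ - z₂)) / riemannZeta ((β : ℂ) * (2 - z₁ - z₂)) =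
      ∑' d, lcmTerm (β * z₁) (β * z₂) β d := by
    rw [tsum_lcmTerm cm₁₂ cm₁ cm₂]
    congr! 2 <;> ring_nf
  set K := ∑' d, ‖lcmTerm (β * z₁) (β * z₂) ((β * θ : ℝ) : ℂ) d‖
  have hK : 0 ≤ K := tsum_nonneg fun _ => norm_nonneg _
  have hlog3 : 1 < Real.log 3 := by
    rw [Real.lt_log_iff_exp_lt (by norm_num)]
    linarith [Real.exp_one_lt_d9]
  have hδ : 0 < Real.log (Real.log 3) := Real.log_pos hlog3
  refine ⟨(2 * K + 1) / Real.log (Real.log 3), by positivity, fun x hx => ?_⟩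
  have hlog : Real.log 3 ≤ Real.log x := Real.log_le_log (by norm_num) hx
  have hloglog : Real.log (Real.log 3) ≤ Real.log (Real.log x) :=
    Real.log_le_log (by linarith) hlog
  have hx0 : 0 < x := by linarith
  rw [hconst]
  refine (norm_primedSum_sigmaGen_mul_sub_le hβ0 z₁ z₂ (by linarith) (by linarith) hsθ
    (summable_norm_lcmTerm cm₁₂ cm₁ cm₂).of_norm (by linarith)).trans ?_
  set M := max (x ^ (1 / (2 * (β : ℝ)) + (z₁.re + z₂.re) / 2 + (β : ℝ) * |z₁.re - z₂.re| / 3))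
    (x ^ θ)
  have hM : x ^ θ ≤ M := le_max_right _ _
  have hpow : 1 ≤ Real.log x ^ 5 := one_le_pow₀ (by linarith)
  have hxθ : 0 < x ^ θ := Real.rpow_pos_of_pos hx0 _
  calc 2 * (K * x ^ θ) ≤ (2 * K + 1) * x ^ θ := by linarith
    _ = (2 * K + 1) / Real.log (Real.log 3) * (x ^ θ * 1 * Real.log (Real.log 3)) := by
      field_simp
    _ ≤ (2 * K + 1) / Real.log (Real.log 3) *
        (M * Real.log x ^ 5 * Real.log (Real.log x)) := by
      have : 0 ≤ M := hxθ.le.trans hM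
      gcongr
end

section
/- Let β and n be positive integers and let s ∈ ℂ with Re(s) > 1. Then the series Σ_{q=1}^∞ c_{q,β}(n)·q^{−βs} converges absolutely and Σ_{q=1}^∞ c_{q,β}(n)·q^{−βs} = σ_{1−s,β}(n)/ζ(βs). -/
open Complex Finset
open scoped Classical

/-- The generalized Ramanujan sum of Cohen: `c_{q,β}(n) = Σ_h exp(2πinh/q^β)` where `h`
runs over `0 ≤ h < q^β` such that `h` and `q^β` have no common `β`-th power divisor `> 1`. -/
noncomputable def cohenRamanujan (β q n : ℕ) : ℂ :=
  ∑ h ∈ (Finset.range (q ^ β)).filter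
      (fun h => ∀ d : ℕ, 1 < d → ¬(d ^ β ∣ h ∧ d ^ β ∣ q ^ β)),
    Complex.exp (2 * Real.pi * Complex.I * n * h / (q ^ β))

open scoped ArithmeticFunction.Moebius

/-- `h` is `β`-coprime to `e ^ β`: they have no common `β`-th power divisor `> 1`. -/
def PowCoprime (β e h : ℕ) : Prop :=
  ∀ d : ℕ, 1 < d → ¬(d ^ β ∣ h ∧ d ^ β ∣ e ^ β)

lemma PowCoprime.dvd_of_mul_eq {β d₁ d₂ e₁ e₂ h₁ h₂ : ℕ} (hd₁ : 0 < d₁) (hd₂ : 0 < d₂)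
    (hde : d₁ * e₁ = d₂ * e₂) (hh : d₁ ^ β * h₁ = d₂ ^ β * h₂) (hcop : PowCoprime β e₁ h₁) :
    d₂ ∣ d₁ := by
  obtain ⟨k, hk⟩ := Nat.dvd_lcm_left d₁ d₂
  have key : ∀ m, d₁ ^ β ∣ m → d₂ ^ β ∣ m → d₁ ^ β * k ^ β ∣ m := fun m h1 h2 ↦ by
    rw [← mul_pow, ← hk, ← Nat.pow_lcm_pow]
    exact Nat.lcm_dvd h1 h2
  have hd : 0 < d₁ ^ β := by positivity
  have hk1 : ¬ 1 < k := fun hlt ↦ hcop k hlt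
    ⟨Nat.dvd_of_mul_dvd_mul_left hd (key _ (dvd_mul_right _ _) (hh ▸ dvd_mul_right _ _)),
      Nat.dvd_of_mul_dvd_mul_left hd (key _ (dvd_mul_right _ _) (by
        rw [← mul_pow, hde, mul_pow]; exact dvd_mul_right _ _))⟩
  have hL : 0 < d₁.lcm d₂ := Nat.lcm_pos hd₁ hd₂
  have hk0 : k ≠ 0 := by rintro rfl; omega
  obtain rfl : k = 1 := by omega
  rw [mul_one] at hk
  exact hk ▸ Nat.dvd_lcm_right d₁ d₂

/-- Every `h` decomposes as `d ^ β * h'` with `d ∣ q` and `h'` being `β`-coprime to `(q / d) ^ β`. -/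
lemma exists_powCoprime_decomposition {β q : ℕ} (hβ : 0 < β) (hq : 0 < q) (h : ℕ) :
    ∃ d e h', d * e = q ∧ d ^ β * h' = h ∧ PowCoprime β e h' := by
  induction q using Nat.strong_induction_on generalizing h with
  | _ q ih =>
    by_cases hcop : PowCoprime β q h
    · exact ⟨1, q, h, by simp, by simp, hcop⟩
    · simp only [PowCoprime, not_forall, not_not] at hcop
      obtain ⟨d, hd, ⟨h₁, rfl⟩, hdq⟩ := hcop
      obtain ⟨e, rfl⟩ := (Nat.pow_dvd_pow_iff hβ.ne').1 hdq
      have he : 0 < e := Nat.pos_of_mul_pos_left hq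
      obtain ⟨d', e', h', rfl, rfl, h3⟩ := ih e (by nlinarith) he h₁
      exact ⟨d * d', e', h', by ring, by ring, h3⟩

lemma sum_exp_range (n N : ℕ) (hN : 0 < N) :
    ∑ h ∈ Finset.range N, Complex.exp (2 * Real.pi * Complex.I * n * h / N) =
      if N ∣ n then (N : ℂ) else 0 := by
  have hN' : (N : ℂ) ≠ 0 := by exact_mod_cast hN.ne'
  set ω := Complex.exp (2 * Real.pi * Complex.I / N) with hω
  have hprim : IsPrimitiveRoot ω N := Complex.isPrimitiveRoot_exp N hN.ne'
  have hterm : ∀ h : ℕ, Complex.exp (2 * Real.pi * Complex.I * n * h / N) = (ω ^ n) ^ h := by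
    intro h
    rw [hω, ← Complex.exp_nat_mul, ← Complex.exp_nat_mul]
    congr 1
    ring
  simp only [hterm]
  split_ifs with hdvd
  · simp [(hprim.pow_eq_one_iff_dvd n).2 hdvd]
  · have hne : ω ^ n ≠ 1 := fun h ↦ hdvd ((hprim.pow_eq_one_iff_dvd n).1 h)
    rw [geom_sum_eq hne, ← pow_mul, mul_comm, pow_mul, hprim.pow_eq_one]
    simp

lemma sum_cohenRamanujan_divisors {β q : ℕ} (hβ : 0 < β) (hq : 0 < q) (n : ℕ) :
    ∑ e ∈ q.divisors, cohenRamanujan β e n = if q ^ β ∣ n then (q : ℂ) ^ β else 0 := by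
  have hgeom := sum_exp_range n (q ^ β) (by positivity)
  push_cast at hgeom
  rw [← hgeom]
  simp only [cohenRamanujan]
  rw [Finset.sum_sigma']
  refine Finset.sum_nbij (fun x ↦ (q / x.1) ^ β * x.2) ?_ ?_ ?_ ?_
  · rintro ⟨e, h⟩ hx
    simp only [Finset.mem_sigma, Nat.mem_divisors, Finset.mem_filter, Finset.mem_range] at hx ⊢
    obtain ⟨⟨⟨d, rfl⟩, -⟩, hlt, -⟩ := hx
    have he : 0 < e := Nat.pos_of_mul_pos_right hq
    have hd : 0 < d := Nat.pos_of_mul_pos_left hq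
    rw [Nat.mul_div_cancel_left _ he, mul_pow, mul_comm]
    gcongr
  · rintro ⟨e₁, h₁⟩ hx₁ ⟨e₂, h₂⟩ hx₂ heq
    simp only [Finset.coe_sigma, Set.mem_sigma_iff, Finset.mem_coe, Nat.mem_divisors,
      Finset.mem_filter, Finset.mem_range] at hx₁ hx₂ heq
    obtain ⟨⟨hdvd₁, -⟩, -, hc₁⟩ := hx₁
    obtain ⟨⟨hdvd₂, -⟩, -, hc₂⟩ := hx₂
    have hq₁ := Nat.div_mul_cancel hdvd₁
    have hq₂ := Nat.div_mul_cancel hdvd₂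
    have hp₁ := Nat.div_pos (Nat.le_of_dvd hq hdvd₁) (Nat.pos_of_dvd_of_pos hdvd₁ hq)
    have hp₂ := Nat.div_pos (Nat.le_of_dvd hq hdvd₂) (Nat.pos_of_dvd_of_pos hdvd₂ hq)
    have hdd : q / e₁ = q / e₂ := Nat.dvd_antisymm
      (PowCoprime.dvd_of_mul_eq hp₂ hp₁ (hq₂.trans hq₁.symm) heq.symm hc₂)
      (PowCoprime.dvd_of_mul_eq hp₁ hp₂ (hq₁.trans hq₂.symm) heq hc₁)
    rw [hdd] at heq hq₁
    obtain rfl : e₁ = e₂ := Nat.eq_of_mul_eq_mul_left hp₂ (hq₁.trans hq₂.symm)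
    obtain rfl : h₁ = h₂ := Nat.eq_of_mul_eq_mul_left (by positivity) heq
    rfl
  · intro h hh
    obtain ⟨d, e, h', rfl, rfl, hcop⟩ := exists_powCoprime_decomposition hβ hq h
    have he : 0 < e := Nat.pos_of_mul_pos_left hq
    have hd : 0 < d := Nat.pos_of_mul_pos_right hq
    simp only [Finset.mem_coe, Finset.mem_range, mul_pow] at hh
    refine ⟨⟨e, h'⟩, ?_, ?_⟩
    · simp only [Finset.coe_sigma, Set.mem_sigma_iff, Finset.mem_coe, Nat.mem_divisors,
        Finset.mem_filter, Finset.mem_range]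
      exact ⟨⟨dvd_mul_left _ _, hq.ne'⟩, lt_of_mul_lt_mul_left' hh, hcop⟩
    · simp [Nat.mul_div_cancel _ he]
  · rintro ⟨e, h⟩ hx
    simp only [Finset.mem_sigma, Nat.mem_divisors] at hx
    obtain ⟨⟨⟨d, rfl⟩, -⟩, -⟩ := hx
    have he : 0 < e := Nat.pos_of_mul_pos_right hq
    have hd : 0 < d := Nat.pos_of_mul_pos_left hq
    have he' : (e : ℂ) ≠ 0 := by exact_mod_cast he.ne'
    have hd' : (d : ℂ) ≠ 0 := by exact_mod_cast hd.ne'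
    simp only [Nat.mul_div_cancel_left _ he]
    congr 1
    push_cast
    field_simp
    ring

lemma cohenRamanujan_eq_convolution {β n q : ℕ} (hβ : 0 < β) (hq : 0 < q) :
    cohenRamanujan β q n =
      LSeries.convolution (fun m ↦ (μ m : ℂ)) (fun m ↦ if m ^ β ∣ n then (m : ℂ) ^ β else 0) q := by
  rw [LSeries.convolution_def]
  exact (ArithmeticFunction.sum_eq_iff_sum_mul_moebius_eq.1
    (fun m hm ↦ sum_cohenRamanujan_divisors hβ hm n) q hq).symm

lemma term_eq_zero_of_notMem {β n : ℕ} (hβ : 0 < β) (hn : 0 < n) (z : ℂ) {m : ℕ}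
    (hm : m ∉ (Finset.Icc 1 n).filter (fun d ↦ d ^ β ∣ n)) :
    LSeries.term (fun m ↦ if m ^ β ∣ n then (m : ℂ) ^ β else 0) z m = 0 := by
  rcases Nat.eq_zero_or_pos m with rfl | hm0
  · simp
  · rw [LSeries.term_of_ne_zero hm0.ne']
    split_ifs with hdvd
    · refine absurd ?_ hm
      simp only [Finset.mem_filter, Finset.mem_Icc]
      exact ⟨⟨hm0, (Nat.le_self_pow hβ.ne' m).trans (Nat.le_of_dvd hn hdvd)⟩, hdvd⟩
    · simp

/-- The Dirichlet series of `m ↦ m ^ β` supported on `m ^ β ∣ n` is a finite divisor sum. -/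
lemma LSeriesHasSum_pow_dvd {β n : ℕ} (hβ : 0 < β) (hn : 0 < n) (s : ℂ) :
    LSeriesHasSum (fun m ↦ if m ^ β ∣ n then (m : ℂ) ^ β else 0) (β * s)
      (sigmaGen (1 - s) β n) := by
  have heq : sigmaGen (1 - s) β n = ∑ m ∈ (Finset.Icc 1 n).filter (fun d ↦ d ^ β ∣ n),
      LSeries.term (fun m ↦ if m ^ β ∣ n then (m : ℂ) ^ β else 0) (β * s) m := by
    refine Finset.sum_congr rfl fun d hd ↦ ?_
    simp only [Finset.mem_filter, Finset.mem_Icc] at hd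
    have hd0 : d ≠ 0 := by omega
    rw [LSeries.term_of_ne_zero hd0, if_pos hd.2, mul_sub, mul_one,
      Complex.cpow_sub _ _ (by exact_mod_cast hd0), Complex.cpow_natCast]
  rw [heq]
  exact hasSum_sum_of_ne_finset_zero fun m hm ↦ term_eq_zero_of_notMem hβ hn (β * s) hm

lemma term_cohenRamanujan_eq {β n : ℕ} (hβ : 0 < β) (z : ℂ) (q : ℕ) :
    cohenRamanujan β q n * (q : ℂ) ^ (-z) =
      LSeries.term (LSeries.convolution (fun m ↦ (μ m : ℂ))
        (fun m ↦ if m ^ β ∣ n then (m : ℂ) ^ β else 0)) z q := by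
  rcases Nat.eq_zero_or_pos q with rfl | hq
  · simp [cohenRamanujan, hβ.ne']
  · rw [LSeries.term_of_ne_zero hq.ne', cohenRamanujan_eq_convolution hβ hq, Complex.cpow_neg,
      div_eq_mul_inv]

theorem cohen_dirichlet_series (β n : ℕ) (hβ : 0 < β) (hn : 0 < n) (s : ℂ)
    (hs : 1 < s.re) :
    Summable (fun q : ℕ => ‖cohenRamanujan β q n * (q : ℂ) ^ (-((β : ℂ) * s))‖) ∧
    ∑' q : ℕ, cohenRamanujan β q n * (q : ℂ) ^ (-((β : ℂ) * s)) =
      sigmaGen (1 - s) β n / riemannZeta ((β : ℂ) * s) := by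
  have hβs : 1 < ((β : ℂ) * s).re := by
    have : (1 : ℝ) ≤ β := by exact_mod_cast hβ
    rw [← Complex.ofReal_natCast, Complex.re_ofReal_mul]
    nlinarith
  have hμ := ArithmeticFunction.LSeriesSummable_moebius_iff.2 hβs
  have hg := LSeriesHasSum_pow_dvd hβ hn s
  have hz := LSeries_one_mul_Lseries_moebius hβs
  rw [LSeries_one_eq_riemannZeta hβs] at hz
  have hconv := hμ.LSeriesHasSum.convolution hg
  simp only [term_cohenRamanujan_eq hβ]
  refine ⟨hconv.LSeriesSummable.norm, hconv.LSeries_eq.trans ?_⟩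
  rw [eq_div_iff (left_ne_zero_of_mul_eq_one hz), mul_comm, ← mul_assoc, hz, one_mul]
end

section
/- For all positive integers β, q, n one has c_{q,β}(n) = Σ_{d : d ∣ q and d^β ∣ n} d^β · μ(q/d), where μ is the Möbius function and the sum runs over positive integers d dividing q such that d^β divides n. -/
open Complex Finset
open scoped Classical

/-- The sum of all `n`-th powers of the `N`-th roots of unity. -/
theorem sum_range_exp_two_pi_mul_div (N n : ℕ) (hN : N ≠ 0) :
    ∑ k ∈ Finset.range N, Complex.exp (2 * Real.pi * Complex.I * n * k / N) =
      if N ∣ n then (N : ℂ) else 0 := by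
  have hη := Complex.isPrimitiveRoot_exp N hN
  have hterm (k : ℕ) : Complex.exp (2 * Real.pi * Complex.I * n * k / N) =
      (Complex.exp (2 * Real.pi * Complex.I / N) ^ n) ^ k := by
    rw [← Complex.exp_nat_mul, ← Complex.exp_nat_mul]
    ring_nf
  simp only [hterm]
  split_ifs with h
  · simp [(hη.pow_eq_one_iff_dvd n).2 h]
  · have hne := mt (hη.pow_eq_one_iff_dvd n).1 h
    rw [geom_sum_eq hne, ← pow_mul, mul_comm n, pow_mul, hη.pow_eq_one, one_pow, sub_self,
      zero_div]

/-- The divisors of `q` whose `β`-th power divides `h` are the divisors of a single number. -/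
theorem exists_divisors_eq_filter_pow_dvd (β q h : ℕ) (hq : q ≠ 0) :
    ∃ g : ℕ, g ≠ 0 ∧ q.divisors.filter (fun d => d ^ β ∣ h) = g.divisors := by
  set S := q.divisors.filter (fun d => d ^ β ∣ h) with hS
  have hmem (d : ℕ) : d ∈ S ↔ d ∣ q ∧ d ^ β ∣ h := by simp [hS, hq]
  have hpow (T : Finset ℕ) (hT : ∀ d ∈ T, d ^ β ∣ h) : T.lcm id ^ β ∣ h := by
    induction T using Finset.induction_on with
    | empty => simp
    | insert a T _ ih =>
      rw [Finset.lcm_insert, id, lcm_eq_nat_lcm, ← Nat.pow_lcm_pow]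
      exact Nat.lcm_dvd (hT a (Finset.mem_insert_self a T))
        (ih fun d hd => hT d (Finset.mem_insert_of_mem hd))
  have hlcm_q : S.lcm id ∣ q := Finset.lcm_dvd fun d hd => ((hmem d).1 hd).1
  have hlcm_h : S.lcm id ^ β ∣ h := hpow S fun d hd => ((hmem d).1 hd).2
  have hlcm_ne : S.lcm id ≠ 0 := ne_zero_of_dvd_ne_zero hq hlcm_q
  refine ⟨S.lcm id, hlcm_ne, Finset.ext fun d => ?_⟩
  rw [Nat.mem_divisors]
  refine ⟨fun hd => ⟨Finset.dvd_lcm (f := id) hd, hlcm_ne⟩, fun hd => ?_⟩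
  exact (hmem d).2 ⟨hd.1.trans hlcm_q, (pow_dvd_pow_of_dvd hd.1 β).trans hlcm_h⟩

/-- The Möbius function detects the absence of a common `β`-th power divisor. -/
theorem sum_moebius_filter_pow_dvd (β q h : ℕ) (hβ : β ≠ 0) (hq : q ≠ 0) :
    ∑ d ∈ q.divisors.filter (fun d => d ^ β ∣ h), ArithmeticFunction.moebius d =
      if ∀ d : ℕ, 1 < d → ¬(d ^ β ∣ h ∧ d ^ β ∣ q ^ β) then 1 else 0 := by
  obtain ⟨g, hg, hS⟩ := exists_divisors_eq_filter_pow_dvd β q h hq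
  have hdvd (d : ℕ) : d ^ β ∣ h ∧ d ^ β ∣ q ^ β ↔ d ∣ g := by
    rw [Nat.pow_dvd_pow_iff hβ]
    simpa [hq, hg, and_comm] using Finset.ext_iff.1 hS d
  have hcond : (∀ d : ℕ, 1 < d → ¬(d ^ β ∣ h ∧ d ^ β ∣ q ^ β)) ↔ g = 1 := by
    simp only [hdvd]
    refine ⟨fun H => ?_, ?_⟩
    · by_contra hg1
      exact H g (by omega) dvd_rfl
    · rintro rfl d hd hd1
      exact hd.ne' (Nat.dvd_one.1 hd1)
  rw [hS, ← ArithmeticFunction.coe_mul_zeta_apply, ArithmeticFunction.moebius_mul_coe_zeta,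
    ArithmeticFunction.one_apply]
  simp only [hcond]

/-- Restricting an exponential sum to multiples of `m` rescales it. -/
theorem sum_range_mul_filter_dvd {M : Type*} [AddCommMonoid M] (f : ℕ → M) (m N : ℕ)
    (hm : m ≠ 0) :
    ∑ h ∈ (Finset.range (m * N)).filter (fun h => m ∣ h), f h =
      ∑ k ∈ Finset.range N, f (m * k) := by
  symm
  refine Finset.sum_bij (fun k _ => m * k) ?_ ?_ ?_ ?_
  · intro k hk
    simp_all [Nat.pos_of_ne_zero hm]
  · intro a _ b _ hab
    exact Nat.eq_of_mul_eq_mul_left (Nat.pos_of_ne_zero hm) hab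
  · intro h hh
    obtain ⟨hlt, k, rfl⟩ := by simpa using hh
    exact ⟨k, by simpa using lt_of_mul_lt_mul_left hlt (Nat.zero_le m), rfl⟩
  · simp

theorem cohen_moebius_identity (β q n : ℕ) (hβ : 0 < β) (hq : 0 < q) (hn : 0 < n) :
    cohenRamanujan β q n =
      ∑ d ∈ q.divisors.filter (fun d => d ^ β ∣ n),
        (d : ℂ) ^ β * ((ArithmeticFunction.moebius (q / d) : ℤ) : ℂ) := by
  have hinner (d : ℕ) (hd : d ∈ q.divisors) :
      ∑ h ∈ (Finset.range (q ^ β)).filter (fun h => d ^ β ∣ h),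
          Complex.exp (2 * Real.pi * Complex.I * n * h / (q ^ β)) =
        if (q / d) ^ β ∣ n then ((q / d : ℕ) : ℂ) ^ β else 0 := by
    obtain ⟨e, rfl⟩ := Nat.dvd_of_mem_divisors hd
    obtain ⟨hd0, he0⟩ := mul_ne_zero_iff.1 hq.ne'
    rw [Nat.mul_div_cancel_left e (Nat.pos_of_ne_zero hd0), mul_pow,
      sum_range_mul_filter_dvd _ _ _ (pow_ne_zero β hd0)]
    have hsum := sum_range_exp_two_pi_mul_div (e ^ β) n (pow_ne_zero β he0)
    rw [Nat.cast_pow] at hsum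
    rw [← hsum]
    refine Finset.sum_congr rfl fun k _ => ?_
    have hdC : (d : ℂ) ^ β ≠ 0 := by exact_mod_cast pow_ne_zero β hd0
    congr 1
    push_cast
    rw [mul_pow, ← mul_div_mul_left _ ((e : ℂ) ^ β) hdC]
    ring
  calc cohenRamanujan β q n
      = ∑ h ∈ Finset.range (q ^ β), ∑ d ∈ q.divisors, if d ^ β ∣ h then
          ((ArithmeticFunction.moebius d : ℤ) : ℂ) *
            Complex.exp (2 * Real.pi * Complex.I * n * h / (q ^ β)) else 0 := by
        rw [cohenRamanujan, Finset.sum_filter]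
        refine Finset.sum_congr rfl fun h _ => ?_
        rw [← Finset.sum_filter, ← Finset.sum_mul, ← Int.cast_sum,
          sum_moebius_filter_pow_dvd β q h hβ.ne' hq.ne']
        split_ifs <;> simp
    _ = ∑ d ∈ q.divisors, ((ArithmeticFunction.moebius d : ℤ) : ℂ) *
          if (q / d) ^ β ∣ n then ((q / d : ℕ) : ℂ) ^ β else 0 := by
        rw [Finset.sum_comm]
        refine Finset.sum_congr rfl fun d hd => ?_
        rw [← hinner d hd, Finset.mul_sum, Finset.sum_filter]
    _ = ∑ d ∈ q.divisors, ((ArithmeticFunction.moebius (q / d) : ℤ) : ℂ) *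
          if d ^ β ∣ n then (d : ℂ) ^ β else 0 := by
        rw [← Nat.sum_div_divisors]
        refine Finset.sum_congr rfl fun d hd => ?_
        rw [Nat.div_div_self (Nat.dvd_of_mem_divisors hd) hq.ne']
    _ = _ := by
        rw [Finset.sum_filter]
        refine Finset.sum_congr rfl fun d _ => ?_
        split_ifs <;> simp [mul_comm]
end

section
/- Let β be a positive integer, z ∈ ℂ, and s ∈ ℂ with Re(s) > max(Re(z) + 1/β, 1). Then the series Σ_{n=1}^∞ σ_{z,β}(n)·n^{−s} converges absolutely and Σ_{n=1}^∞ σ_{z,β}(n)·n^{−s} = ζ(s)·ζ(β(s − z)). -/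
open Complex Finset
open scoped Classical

/-- The function supported on perfect `β`-th powers, taking the value `d^{βz}` at `d^β`. -/
noncomputable def powerIndicator (z : ℂ) (β : ℕ) : ℕ → ℂ :=
  Function.extend (fun d : ℕ => d ^ β) (fun d : ℕ => (d : ℂ) ^ ((β : ℂ) * z)) 0

lemma powerIndicator_pow (z : ℂ) {β : ℕ} (hβ : 0 < β) (d : ℕ) :
    powerIndicator z β (d ^ β) = (d : ℂ) ^ ((β : ℂ) * z) :=
  (Nat.pow_left_injective hβ.ne').extend_apply _ _ d

lemma powerIndicator_eq_zero (z : ℂ) {β m : ℕ} (hm : m ∉ Set.range fun d : ℕ => d ^ β) :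
    powerIndicator z β m = 0 := by
  rw [powerIndicator, Function.extend_apply' _ _ _ (by simpa using hm), Pi.zero_apply]

lemma LSeriesHasSum_powerIndicator {β : ℕ} (hβ : 0 < β) {z s : ℂ}
    (hs : 1 < ((β : ℂ) * (s - z)).re) :
    LSeriesHasSum (powerIndicator z β) s (riemannZeta ((β : ℂ) * (s - z))) := by
  refine ((Nat.pow_left_injective hβ.ne').hasSum_iff fun m hm ↦ ?_).mp ?_
  · simp [LSeries.term, powerIndicator_eq_zero z hm]
  · suffices h : LSeries.term (powerIndicator z β) s ∘ (fun d : ℕ ↦ d ^ β) =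
        LSeries.term 1 ((β : ℂ) * (s - z)) from h ▸ LSeriesHasSum_one hs
    ext d
    rcases eq_or_ne d 0 with rfl | hd
    · simp [hβ.ne']
    · have hd' : (d : ℂ) ≠ 0 := Nat.cast_ne_zero.mpr hd
      rw [Function.comp_apply, LSeries.term_of_ne_zero (pow_ne_zero β hd),
        LSeries.term_of_ne_zero hd, powerIndicator_pow z hβ, Nat.cast_pow,
        ← natCast_cpow_natCast_mul, Pi.one_apply, mul_sub, cpow_sub _ _ hd', one_div_div]

lemma convolution_powerIndicator_one (z : ℂ) {β : ℕ} (hβ : 0 < β) (n : ℕ) :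
    LSeries.convolution (powerIndicator z β) 1 n = sigmaGen z β n := by
  rcases eq_or_ne n 0 with rfl | hn
  · simp [sigmaGen]
  simp only [LSeries.convolution_def, Pi.one_apply, mul_one]
  rw [Nat.sum_divisorsAntidiagonal (fun m _ ↦ powerIndicator z β m), sigmaGen]
  symm
  refine Finset.sum_of_injOn (fun d ↦ d ^ β) (Nat.pow_left_injective hβ.ne').injOn ?_ ?_ ?_
  · intro d hd
    simp_all
  · intro m hm hm'
    refine powerIndicator_eq_zero z ?_
    rintro ⟨d, rfl⟩
    refine hm' ⟨d, ?_, rfl⟩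
    have hdvd := Nat.dvd_of_mem_divisors hm
    have hd0 : d ≠ 0 := by
      rintro rfl
      simp [hβ.ne', hn] at hdvd
    have hle := (Nat.le_self_pow hβ.ne' d).trans (Nat.le_of_dvd (Nat.pos_of_ne_zero hn) hdvd)
    simpa [hle, hdvd] using Nat.one_le_iff_ne_zero.mpr hd0
  · intro d _
    exact (powerIndicator_pow z hβ d).symm

theorem sigma_dirichlet_series (β : ℕ) (hβ : 0 < β) (z s : ℂ)
    (hs : max (z.re + 1 / (β : ℝ)) 1 < s.re) :
    Summable (fun n : ℕ => ‖sigmaGen z β n * (n : ℂ) ^ (-s)‖) ∧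
    ∑' n : ℕ, sigmaGen z β n * (n : ℂ) ^ (-s) =
      riemannZeta s * riemannZeta ((β : ℂ) * (s - z)) := by
  obtain ⟨hz, h1⟩ := max_lt_iff.mp hs
  have hre : 1 < ((β : ℂ) * (s - z)).re := by
    rw [← ofReal_natCast, re_ofReal_mul, sub_re]
    have hβ' : (0 : ℝ) < β := Nat.cast_pos.mpr hβ
    rw [mul_comm, ← div_lt_iff₀ hβ']
    linarith
  have hsum := (LSeriesHasSum_powerIndicator hβ hre).convolution (LSeriesHasSum_one h1)
  have hterm : LSeries.term (LSeries.convolution (powerIndicator z β) 1) s =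
      fun n : ℕ => sigmaGen z β n * (n : ℂ) ^ (-s) := by
    ext n
    rcases eq_or_ne n 0 with rfl | hn
    · simp [sigmaGen]
    · rw [LSeries.term_of_ne_zero hn, convolution_powerIndicator_one z hβ, cpow_neg, div_eq_mul_inv]
  rw [LSeriesHasSum, hterm] at hsum
  exact ⟨hsum.summable.norm, by rw [hsum.tsum_eq, mul_comm]⟩
end
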